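/- arXiv:cond-mat/0302345 — 11 statements merged into one kernel-verified Lean document; each statement's English description precedes it below -/
import Mathlib

section
/- Let m, n be integers with 1 ≤ m < n, and set α = (n²+m²)/(n²−m²), β = 2m²/(n²−m²), γ = 2n²/(n²−m²). Let B be the (m+n)×(m+n) real matrix with entries (indices running from 1 to m+n): B_{1,m} = −α, B_{1,m+n} = β, B_{m+1,m} = −γ, B_{m+1,m+n} = α, B_{i,i−1} = 1 for 2 ≤ i ≤ m and for m+2 ≤ i ≤ m+n, and all other entries equal to 0. Then the characteristic polynomial of B is det(λI − B) = λ^{m+n} + αλ^n − αλ^m − 1. -/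
open Polynomial

/-- The `(m+n)×(m+n)` transition matrix `B` (0-based indices; row/column `i` here
corresponds to index `i+1` of the paper): `B_{1,m} = −α`, `B_{1,m+n} = β`,
`B_{m+1,m} = −γ`, `B_{m+1,m+n} = α`, `B_{i,i−1} = 1` for `2 ≤ i ≤ m` and
`m+2 ≤ i ≤ m+n`, all other entries `0`. -/
def pistonMatrixB (m n : ℕ) (α β γ : ℝ) : Matrix (Fin (m + n)) (Fin (m + n)) ℝ :=
  fun i j =>
    if i.val = 0 ∧ j.val = m - 1 then -α
    else if i.val = 0 ∧ j.val = m + n - 1 then β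
    else if i.val = m ∧ j.val = m - 1 then -γ
    else if i.val = m ∧ j.val = m + n - 1 then α
    else if j.val + 1 = i.val ∧ i.val ≠ m then 1
    else 0

/-- The matrix `x I - S`, where `S` is the sum of two nilpotent shift blocks of sizes `m` and `n`. -/
def blockShiftResolvent (m n : ℕ) (x : ℝ) : Matrix (Fin (m + n)) (Fin (m + n)) ℝ :=
  fun i j => if i = j then x else if j.val + 1 = i.val ∧ i.val ≠ m then -1 else 0

/-- The two columns solving `(x I - S) W = (e_0, e_m)`. -/
noncomputable def blockShiftColumns (m n : ℕ) (x : ℝ) : Matrix (Fin (m + n)) (Fin 2) ℝ :=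
  fun i c =>
    if c = 0 then (if i.val < m then x⁻¹ ^ (i.val + 1) else 0)
    else (if i.val < m then 0 else x⁻¹ ^ (i.val - m + 1))

/-- The two nontrivial rows of the piston matrix. -/
def pistonRows (m n : ℕ) (α β γ : ℝ) : Matrix (Fin 2) (Fin (m + n)) ℝ :=
  fun c j =>
    (if j.val = m - 1 then (if c = 0 then -α else -γ) else 0) +
      (if j.val = m + n - 1 then (if c = 0 then β else α) else 0)

theorem det_blockShiftResolvent (m n : ℕ) (x : ℝ) :
    (blockShiftResolvent m n x).det = x ^ (m + n) := by
  rw [Matrix.det_of_isLowerTriangular]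
  · simp [blockShiftResolvent]
  · intro i j hij
    have hij : i.val < j.val := hij
    have h1 : i ≠ j := fun h => by simp [h] at hij
    have h2 : ¬ (j.val + 1 = i.val ∧ i.val ≠ m) := by omega
    simp [blockShiftResolvent, h1, h2]

theorem blockShiftResolvent_mul_columns (m n : ℕ) (hm : 0 < m) {x : ℝ} (hx : x ≠ 0) :
    blockShiftResolvent m n x * blockShiftColumns m n x =
      Matrix.of fun i c => if i.val = (if c = 0 then 0 else m) then 1 else 0 := by
  ext i c
  have hsplit : ∀ j, blockShiftResolvent m n x i j * blockShiftColumns m n x j c =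
      (if i = j then x * blockShiftColumns m n x j c else 0) -
        (if j.val + 1 = i.val ∧ i.val ≠ m then blockShiftColumns m n x j c else 0) := by
    intro j
    unfold blockShiftResolvent
    split_ifs with h1 h2 <;> first | (subst h1; omega) | simp
  have hpow : ∀ k : ℕ, x * x⁻¹ ^ (k + 1) = x⁻¹ ^ k := fun k => by
    rw [pow_succ', mul_inv_cancel_left₀ hx]
  rw [Matrix.mul_apply, Finset.sum_congr rfl fun j _ => hsplit j, Finset.sum_sub_distrib,
    Finset.sum_ite_eq, if_pos (Finset.mem_univ i)]
  by_cases hi : i.val = 0 ∨ i.val = m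
  · rw [Finset.sum_eq_zero fun j _ => if_neg (by omega), sub_zero]
    rcases hi with hi | hi <;> fin_cases c <;>
      simp [blockShiftColumns, hi, hm, hm.ne, hm.ne', hx]
  · have hlt := i.isLt
    rw [Finset.sum_eq_single (⟨i.val - 1, by omega⟩ : Fin (m + n))
      (fun j _ hj => if_neg fun h => hj (Fin.ext (by simp; omega))) (by simp),
      if_pos (by simp; omega)]
    obtain ⟨k, hk⟩ : ∃ k, i.val = k + 1 := ⟨i.val - 1, by omega⟩
    by_cases him : i.val < m
    · have : k < m := by omega
      have h1 : k + 1 < m := by omega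
      have h2 : k + 1 ≠ m := by omega
      have h3 := hpow (k + 1)
      fin_cases c <;> simp [blockShiftColumns, hk, h1, h2, this, -inv_pow, h3]
    · have h0 : ¬ k + 1 < m := by omega
      have h1 : ¬ k < m := by omega
      have h2 : k + 1 - m = k - m + 1 := by omega
      have h3 : k + 1 ≠ m := by omega
      have h4 := hpow (k - m + 1)
      fin_cases c <;> simp [blockShiftColumns, hk, h0, h1, h2, h3, -inv_pow, h4]

theorem pistonRows_mul_columns (m n : ℕ) (hm : 0 < m) (hn : 0 < n) (α β γ x : ℝ) :
    pistonRows m n α β γ * blockShiftColumns m n x =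
      !![-α * x⁻¹ ^ m, β * x⁻¹ ^ n; -γ * x⁻¹ ^ m, α * x⁻¹ ^ n] := by
  have hsum : ∀ (k : ℕ) (hk : k < m + n) (a : ℝ) (f : Fin (m + n) → ℝ),
      ∑ j : Fin (m + n), (if j.val = k then a else 0) * f j = a * f ⟨k, hk⟩ := by
    intro k hk a f
    rw [Finset.sum_eq_single ⟨k, hk⟩ (fun j _ hj => by
      rw [if_neg fun h => hj (Fin.ext h), zero_mul]) (by simp), if_pos rfl]
  have h1 : m - 1 + 1 = m := by omega
  have h2 : ¬ m + n - 1 < m := by omega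
  have h3 : m + n - 1 - m + 1 = n := by omega
  ext c d
  simp only [Matrix.mul_apply, pistonRows, add_mul, Finset.sum_add_distrib]
  rw [hsum _ (by omega), hsum _ (by omega)]
  fin_cases c <;> fin_cases d <;> simp [blockShiftColumns, hm, h1, h2, h3]

theorem scalar_sub_pistonMatrixB (m n : ℕ) (hm : 0 < m) (hn : 0 < n) (α β γ : ℝ) {x : ℝ}
    (hx : x ≠ 0) :
    Matrix.scalar (Fin (m + n)) x - pistonMatrixB m n α β γ =
      blockShiftResolvent m n x *
        (1 - blockShiftColumns m n x * pistonRows m n α β γ) := by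
  rw [mul_sub, mul_one, ← Matrix.mul_assoc, blockShiftResolvent_mul_columns m n hm hx]
  ext i j
  have hi := i.isLt
  have hj := j.isLt
  simp only [Matrix.sub_apply, Matrix.scalar_apply, Matrix.diagonal_apply, Matrix.mul_apply,
    Fin.sum_univ_two, Matrix.of_apply, blockShiftResolvent, pistonMatrixB, pistonRows, Fin.ext_iff]
  simp only [Fin.val_zero, Fin.val_one, if_true, one_ne_zero, if_false]
  by_cases h0 : i.val = 0 <;> by_cases h1 : i.val = m <;> by_cases h2 : j.val = m - 1 <;>
    by_cases h3 : j.val = m + n - 1 <;> try omega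
  all_goals
    have h4 : m ≠ 0 := hm.ne'
    have h5 : m - 1 ≠ m + n - 1 := by omega
    grind

theorem det_scalar_sub_pistonMatrixB (m n : ℕ) (hm : 0 < m) (hn : 0 < n) (α β γ : ℝ) {x : ℝ}
    (hx : x ≠ 0) :
    (Matrix.scalar (Fin (m + n)) x - pistonMatrixB m n α β γ).det =
      (x ^ m + α) * (x ^ n - α) + β * γ := by
  rw [scalar_sub_pistonMatrixB m n hm hn α β γ hx, Matrix.det_mul, det_blockShiftResolvent,
    Matrix.det_one_sub_mul_comm, pistonRows_mul_columns m n hm hn, Matrix.det_fin_two]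
  simp only [Matrix.sub_apply, Matrix.one_apply, Matrix.of_apply, Matrix.cons_val', Matrix.cons_val]
  simp only [inv_pow]
  norm_num
  field_simp
  ring

/-- The characteristic polynomial of the transition matrix `B` is
`λ^{m+n} + α λ^n − α λ^m − 1`. -/
theorem pistonMatrixB_charpoly (m n : ℕ) (hm : 1 ≤ m) (hmn : m < n)
    (α β γ : ℝ)
    (hα : α = ((n : ℝ) ^ 2 + (m : ℝ) ^ 2) / ((n : ℝ) ^ 2 - (m : ℝ) ^ 2))
    (hβ : β = 2 * (m : ℝ) ^ 2 / ((n : ℝ) ^ 2 - (m : ℝ) ^ 2))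
    (hγ : γ = 2 * (n : ℝ) ^ 2 / ((n : ℝ) ^ 2 - (m : ℝ) ^ 2)) :
    (pistonMatrixB m n α β γ).charpoly =
      X ^ (m + n) + C α * X ^ n - C α * X ^ m - C 1 := by
  have hn : 0 < n := by omega
  have hden : (n : ℝ) ^ 2 - (m : ℝ) ^ 2 ≠ 0 := by
    have h : (m : ℝ) < n := by exact_mod_cast hmn
    have h0 : (0 : ℝ) ≤ m := m.cast_nonneg
    nlinarith
  have hrel : β * γ = α ^ 2 - 1 := by
    rw [hα, hβ, hγ]
    field_simp
    ring
  refine Polynomial.eq_of_infinite_eval_eq _ _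
    ((Set.finite_singleton (0 : ℝ)).infinite_compl.mono ?_)
  intro x hx
  have hx : x ≠ 0 := hx
  rw [Set.mem_ofPred_eq, Matrix.eval_charpoly, det_scalar_sub_pistonMatrixB m n hm hn α β γ hx, hrel]
  simp only [eval_sub, eval_add, eval_mul, eval_pow, eval_X, eval_C]
  ring
end

section
/- Let m, n be integers with 1 ≤ m < n, m odd and n even, set α = (n²+m²)/(n²−m²), and define P(λ) = λ^{m+n} + αλ^n − αλ^m − 1. Then P has exactly one real root λ* in the interval (−∞, −1), this root satisfies λ* < −1 strictly (indeed P(−1) = 2(α−1) > 0), and λ* is a simple root: P(λ*) = 0 and P′(λ*) ≠ 0. -/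
/-- The function `(a, b) ↦ (a * b + 1) / (a + b)` is strictly increasing for `a, b > 1`,
with denominators cleared. -/
theorem mul_add_one_mul_add_lt {a b A B : ℝ} (ha : 1 < a) (hb : 1 < b) (hA : a < A)
    (hB : b < B) : (a * b + 1) * (A + B) < (A * B + 1) * (a + b) := by
  have h1 : 0 < (B - b) * (a * A - 1) := mul_pos (by linarith) (by nlinarith)
  have h2 : 0 < (A - a) * (b * B - 1) := mul_pos (by linarith) (by nlinarith)
  nlinarith

/-- At most one `t > 1` solves `t ^ m * t ^ n + 1 = α * (t ^ n + t ^ m)`. -/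
theorem root_not_lt {m n : ℕ} (hm : m ≠ 0) (hn : n ≠ 0) {α s t : ℝ} (hs : 1 < s)
    (hsr : s ^ m * s ^ n + 1 = α * (s ^ n + s ^ m))
    (htr : t ^ m * t ^ n + 1 = α * (t ^ n + t ^ m)) : ¬ s < t := by
  intro hst
  have h := mul_add_one_mul_add_lt (one_lt_pow₀ hs hm) (one_lt_pow₀ hs hn)
    (pow_lt_pow_left₀ hst (by linarith) hm) (pow_lt_pow_left₀ hst (by linarith) hn)
  rw [hsr, htr] at h
  exact h.ne (by ring)

/-- For `t` large compared with `α`, the leading term dominates. -/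
theorem mul_add_pow_lt {m n : ℕ} (hm : 1 ≤ m) (hmn : m < n) {α t : ℝ} (hα : 0 ≤ α)
    (ht : 1 ≤ t) (hαt : 2 * α ≤ t) : α * (t ^ n + t ^ m) < t ^ m * t ^ n + 1 := by
  have h1 : t ≤ t ^ m := le_self_pow₀ ht (by omega)
  have h2 : t ^ m ≤ t ^ n := pow_le_pow_right₀ ht hmn.le
  have h3 : 2 * α * t ^ n ≤ t ^ m * t ^ n :=
    mul_le_mul_of_nonneg_right (hαt.trans h1) (by positivity)
  have h4 := mul_le_mul_of_nonneg_left h2 hα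
  linarith

/-- Theorem 5.1 (existence, uniqueness, simplicity): for `r = m/n` with `m` odd
and `n` even, `P(λ) = λ^{m+n} + αλ^n − αλ^m − 1` satisfies `P(−1) = 2(α−1) > 0`
and has a unique root `λ* < −1`, which is moreover simple. -/
theorem charpoly_unique_simple_root (m n : ℕ) (hm : 1 ≤ m) (hmn : m < n)
    (hmo : Odd m) (hne : Even n)
    (α : ℝ) (hα : α = ((n : ℝ) ^ 2 + (m : ℝ) ^ 2) / ((n : ℝ) ^ 2 - (m : ℝ) ^ 2))
    (P : ℝ → ℝ)
    (hP : ∀ x : ℝ, P x = x ^ (m + n) + α * x ^ n - α * x ^ m - 1) :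
    P (-1) = 2 * (α - 1) ∧ 0 < P (-1) ∧
    ∃ l : ℝ, l < -1 ∧ P l = 0 ∧ deriv P l ≠ 0 ∧
      ∀ l' : ℝ, l' < -1 → P l' = 0 → l' = l := by
  have hm' : m ≠ 0 := by omega
  have hn' : n ≠ 0 := by omega
  have hmR : (0 : ℝ) < m := by exact_mod_cast hm
  have hmnR : (m : ℝ) < n := by exact_mod_cast hmn
  have hα1 : 1 < α := by
    rw [hα, lt_div_iff₀ (by nlinarith)]
    nlinarith
  have hneg (t : ℝ) : P (-t) = α * (t ^ n + t ^ m) - (t ^ m * t ^ n + 1) := by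
    rw [hP, pow_add, hmo.neg_pow, hne.neg_pow]
    ring
  have hroot {t : ℝ} (h : P (-t) = 0) : t ^ m * t ^ n + 1 = α * (t ^ n + t ^ m) := by
    rw [hneg] at h
    linarith
  have hP1 : P (-1) = 2 * (α - 1) := by
    rw [hneg]
    simp only [one_pow]
    ring
  have hpos : 0 < P (-1) := by linarith
  have hderiv (x : ℝ) : HasDerivAt P
      ((m + n : ℕ) * x ^ (m + n - 1) + α * (n * x ^ (n - 1)) - α * (m * x ^ (m - 1))) x := by
    rw [funext hP]
    exact (((hasDerivAt_pow (m + n) x).add ((hasDerivAt_pow n x).const_mul α)).sub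
      ((hasDerivAt_pow m x).const_mul α)).sub_const 1
  have hcont : Continuous P := continuous_iff_continuousAt.2 fun x => (hderiv x).continuousAt
  have hlarge : P (-(2 * α)) < 0 := by
    rw [hneg, sub_neg]
    exact mul_add_pow_lt hm hmn (by linarith) (by linarith) le_rfl
  obtain ⟨l, ⟨-, hl1⟩, hl0⟩ := intermediate_value_Ioo (by linarith : -(2 * α) ≤ -1)
    hcont.continuousOn ⟨hlarge, hpos⟩
  obtain ⟨t, rfl⟩ : ∃ t, l = -t := ⟨-l, by ring⟩
  have ht : 1 < t := by linarith
  refine ⟨hP1, hpos, -t, hl1, hl0, ?_, ?_⟩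
  · rw [(hderiv (-t)).deriv]
    intro h
    have h2 : (m + n : ℝ) * (t ^ m * t ^ n) = α * (n * t ^ n + m * t ^ m) := by
      have h3 := congrArg (-t * ·) h
      have e1 := mul_pow_sub_one (show m + n ≠ 0 by omega) (-t)
      have e2 := mul_pow_sub_one hn' (-t)
      have e3 := mul_pow_sub_one hm' (-t)
      rw [pow_add, hmo.neg_pow, hne.neg_pow] at e1
      rw [hne.neg_pow] at e2
      rw [hmo.neg_pow] at e3
      push_cast at h3
      linear_combination (m + n : ℝ) * e1 + α * n * e2 - α * m * e3 - h3
    have hr := hroot hl0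
    have ha := one_lt_pow₀ ht hm'
    have hb := one_lt_pow₀ ht hn'
    generalize t ^ m = a at *
    generalize t ^ n = b at *
    have h4 : 0 < m * a * (b ^ 2 - 1) := mul_pos (by positivity) (by nlinarith)
    have h5 : 0 < n * b * (a ^ 2 - 1) :=
      mul_pos (mul_pos (by linarith) (by linarith)) (by nlinarith)
    have h6 : m * a * (b ^ 2 - 1) + n * b * (a ^ 2 - 1) = 0 := by
      linear_combination (a + b) * h2 - (n * b + m * a) * hr
    linarith
  · intro l' hl' hl'0
    obtain ⟨s, rfl⟩ : ∃ s, l' = -s := ⟨-l', by ring⟩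
    have hs : 1 < s := by linarith
    rw [neg_inj]
    exact le_antisymm (not_lt.1 (root_not_lt hm' hn' ht (hroot hl0) (hroot hl'0)))
      (not_lt.1 (root_not_lt hm' hn' hs (hroot hl'0) (hroot hl0)))
end

section
/- For each real r ∈ (0,1) set α_r = (1+r²)/(1−r²) and consider the equation −Λ^{1+1/r} + α_r·Λ^{1/r} + α_r·Λ − 1 = 0 in the real unknown Λ. Then for every r ∈ (0,1) this equation has exactly one solution Λ_r in the interval (1, ∞), and the function r ↦ Λ_r is continuous on (0,1). -/
open Set

/-- The Möbius map `t ↦ (t - 1) / (t + 1)` is strictly increasing on `[1, ∞)`. -/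
lemma strictMonoOn_sub_one_div_add_one :
    StrictMonoOn (fun t : ℝ => (t - 1) / (t + 1)) (Ici 1) := by
  intro s hs t ht hst
  rw [mem_Ici] at hs ht
  change (s - 1) / (s + 1) < (t - 1) / (t + 1)
  rw [div_lt_div_iff₀ (by linarith) (by linarith)]
  linarith

/-- With `Λ = exp (2 r y)`, this is `tanh y * tanh (r y)`. -/
noncomputable def tanhProduct (r Λ : ℝ) : ℝ :=
  (Λ ^ (1 / r) - 1) / (Λ ^ (1 / r) + 1) * ((Λ - 1) / (Λ + 1))

lemma strictMonoOn_tanhProduct {r : ℝ} (hr : 0 < r) :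
    StrictMonoOn (tanhProduct r) (Ici 1) := by
  intro s hs t ht hst
  rw [mem_Ici] at hs ht
  have hr' : 0 < 1 / r := by positivity
  have hs' : 1 ≤ s ^ (1 / r) := Real.one_le_rpow hs hr'.le
  have ht' : 1 ≤ t ^ (1 / r) := Real.one_le_rpow ht hr'.le
  have hpow : s ^ (1 / r) < t ^ (1 / r) := Real.rpow_lt_rpow (by linarith) hst hr'
  exact mul_lt_mul'' (strictMonoOn_sub_one_div_add_one hs' ht' hpow)
    (strictMonoOn_sub_one_div_add_one hs ht hst)
    (div_nonneg (by linarith) (by linarith)) (div_nonneg (by linarith) (by linarith))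

lemma tanhProduct_one (r : ℝ) : tanhProduct r 1 = 0 := by
  simp [tanhProduct]

lemma characteristic_eq_zero_iff {r Λ : ℝ} (hr : r ∈ Ioo (0 : ℝ) 1) (hΛ : 1 ≤ Λ) :
    -Λ ^ (1 + 1 / r) + ((1 + r ^ 2) / (1 - r ^ 2)) * Λ ^ (1 / r) +
      ((1 + r ^ 2) / (1 - r ^ 2)) * Λ - 1 = 0 ↔ tanhProduct r Λ = r ^ 2 := by
  have hr2 : 1 - r ^ 2 ≠ 0 := by nlinarith [hr.1, hr.2]
  have hΛ0 : 0 < Λ := by linarith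
  have hpow : 0 < Λ ^ (1 / r) := Real.rpow_pos_of_pos hΛ0 _
  rw [tanhProduct, Real.rpow_add hΛ0, Real.rpow_one]
  generalize Λ ^ (1 / r) = M at hpow
  rw [div_mul_div_comm, div_eq_iff (by positivity)]
  have key : -(Λ * M) + (1 + r ^ 2) / (1 - r ^ 2) * M + (1 + r ^ 2) / (1 - r ^ 2) * Λ - 1 =
      (r ^ 2 * ((M + 1) * (Λ + 1)) - (M - 1) * (Λ - 1)) / (1 - r ^ 2) := by
    field_simp
    ring
  rw [key, div_eq_zero_iff, or_iff_left hr2, sub_eq_zero, eq_comm]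

lemma continuousAt_tanhProduct_left {r Λ : ℝ} (hr : r ≠ 0) (hΛ : 1 ≤ Λ) :
    ContinuousAt (fun s => tanhProduct s Λ) r := by
  have hΛ0 : 0 < Λ := by linarith
  have hpow : ContinuousAt (fun s : ℝ => Λ ^ (1 / s)) r :=
    (Real.continuousAt_const_rpow hΛ0.ne').comp (continuousAt_const.div continuousAt_id hr)
  have hne : Λ ^ (1 / r) + 1 ≠ 0 := by positivity
  exact ((hpow.sub continuousAt_const).div (hpow.add continuousAt_const) hne).mul
    continuousAt_const

lemma continuousOn_tanhProduct_right (r : ℝ) : ContinuousOn (tanhProduct r) (Ici 1) := by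
  intro Λ hΛ
  have hΛ0 : 0 < Λ := lt_of_lt_of_le one_pos hΛ
  have hpow : ContinuousAt (fun x : ℝ => x ^ (1 / r)) Λ :=
    Real.continuousAt_rpow_const _ _ (Or.inl hΛ0.ne')
  have hne : Λ ^ (1 / r) + 1 ≠ 0 := by positivity
  have hne' : Λ + 1 ≠ 0 := by positivity
  exact (((hpow.sub continuousAt_const).div (hpow.add continuousAt_const) hne).mul
    ((continuousAt_id.sub continuousAt_const).div
      (continuousAt_id.add continuousAt_const) hne')).continuousWithinAt

lemma exists_tanhProduct_eq_sq {r : ℝ} (hr : r ∈ Ioo (0 : ℝ) 1) :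
    ∃ Λ : ℝ, 1 < Λ ∧ tanhProduct r Λ = r ^ 2 := by
  obtain ⟨h0, h1⟩ := hr
  set B : ℝ := (1 + r) / (1 - r) with hB
  have h1r : 0 < 1 - r := by linarith
  have hB1 : 1 ≤ B := by rw [hB, le_div_iff₀ h1r]; linarith
  have hBr : (B - 1) / (B + 1) = r := by
    rw [div_eq_iff (by linarith), hB]
    field_simp
    ring
  have hBpow : B ≤ B ^ (1 / r) :=
    Real.self_le_rpow_of_one_le hB1 (by rw [le_div_iff₀ h0]; linarith)
  have hle : r ≤ (B ^ (1 / r) - 1) / (B ^ (1 / r) + 1) := by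
    rw [← hBr]
    simpa only [hBr] using strictMonoOn_sub_one_div_add_one.monotoneOn hB1 (hB1.trans hBpow) hBpow
  have hBG : r ^ 2 ≤ tanhProduct r B := by
    rw [tanhProduct, hBr, sq]
    exact mul_le_mul_of_nonneg_right hle h0.le
  obtain ⟨Λ, hΛ, hΛr⟩ := intermediate_value_Icc hB1
    ((continuousOn_tanhProduct_right r).mono Icc_subset_Ici_self)
    ⟨by rw [tanhProduct_one]; positivity, hBG⟩
  refine ⟨Λ, lt_of_le_of_ne hΛ.1 ?_, hΛr⟩
  rintro rfl
  rw [tanhProduct_one] at hΛr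
  exact (pow_pos h0 2).ne hΛr

lemma continuousOn_of_tanhProduct_eq_sq {L : ℝ → ℝ}
    (hL : ∀ r ∈ Ioo (0 : ℝ) 1, 1 < L r ∧ tanhProduct r (L r) = r ^ 2) :
    ContinuousOn L (Ioo 0 1) := by
  intro r hr
  have hsq : ContinuousAt (fun s : ℝ => s ^ 2) r := (continuous_pow 2).continuousAt
  refine ContinuousAt.continuousWithinAt (tendsto_order.2 ⟨fun a ha => ?_, fun a ha => ?_⟩)
  · rcases lt_or_ge a 1 with ha1 | ha1
    · filter_upwards [Ioo_mem_nhds hr.1 hr.2] with s hs using ha1.trans (hL s hs).1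
    · have hlt : tanhProduct r a < r ^ 2 := by
        rw [← (hL r hr).2]
        exact strictMonoOn_tanhProduct hr.1 ha1 (hL r hr).1.le ha
      filter_upwards [Ioo_mem_nhds hr.1 hr.2,
        (continuousAt_tanhProduct_left hr.1.ne' ha1).eventually_lt hsq hlt] with s hs hlt'
      rw [← (hL s hs).2] at hlt'
      exact ((strictMonoOn_tanhProduct hs.1).lt_iff_lt ha1 (hL s hs).1.le).1 hlt'
  · have ha1 : 1 ≤ a := (hL r hr).1.le.trans ha.le
    have hlt : r ^ 2 < tanhProduct r a := by
      rw [← (hL r hr).2]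
      exact strictMonoOn_tanhProduct hr.1 (hL r hr).1.le ha1 ha
    filter_upwards [Ioo_mem_nhds hr.1 hr.2,
      hsq.eventually_lt (continuousAt_tanhProduct_left hr.1.ne' ha1) hlt] with s hs hlt'
    rw [← (hL s hs).2] at hlt'
    exact ((strictMonoOn_tanhProduct hs.1).lt_iff_lt (hL s hs).1.le ha1).1 hlt'

/-- Theorem 5.1 (continuity): for each `r ∈ (0,1)` the equation
`−Λ^{1+1/r} + ((1+r²)/(1−r²))·Λ^{1/r} + ((1+r²)/(1−r²))·Λ − 1 = 0` has exactly one
solution `Λ_r ∈ (1,∞)`, and `r ↦ Λ_r` is continuous on `(0,1)`. -/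
theorem expansion_factor_exists_unique_continuous :
    ∃ L : ℝ → ℝ, ContinuousOn L (Set.Ioo (0:ℝ) 1) ∧
      ∀ r ∈ Set.Ioo (0:ℝ) 1,
        1 < L r ∧
        (-(L r) ^ (1 + 1 / r) + ((1 + r ^ 2) / (1 - r ^ 2)) * (L r) ^ (1 / r) +
          ((1 + r ^ 2) / (1 - r ^ 2)) * L r - 1 = 0) ∧
        ∀ Λ : ℝ, 1 < Λ →
          (-Λ ^ (1 + 1 / r) + ((1 + r ^ 2) / (1 - r ^ 2)) * Λ ^ (1 / r) +
            ((1 + r ^ 2) / (1 - r ^ 2)) * Λ - 1 = 0) → Λ = L r := by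
  choose! L hL using fun r (hr : r ∈ Ioo (0 : ℝ) 1) => exists_tanhProduct_eq_sq hr
  refine ⟨L, continuousOn_of_tanhProduct_eq_sq hL, fun r hr => ?_⟩
  obtain ⟨hL1, hLr⟩ := hL r hr
  refine ⟨hL1, (characteristic_eq_zero_iff hr hL1.le).2 hLr, fun Λ hΛ hroot => ?_⟩
  exact (strictMonoOn_tanhProduct hr.1).injOn hΛ.le hL1.le
    (((characteristic_eq_zero_iff hr hΛ.le).1 hroot).trans hLr.symm)
end

section
/- Let Λ_r denote, for r ∈ (0,1), the unique solution in (1,∞) of −Λ^{1+1/r} + ((1+r²)/(1−r²))·(Λ^{1/r} + Λ) − 1 = 0. Then there is a constant c > 0 such that Λ_r = 1 + c·r^{3/2} + O(r²) as r → 0⁺; that is, (Λ_r − 1 − c·r^{3/2})/r² remains bounded as r → 0⁺. -/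
open Set Filter Asymptotics

theorem sinh_le_mul_cosh {y : ℝ} (hy : 0 ≤ y) : Real.sinh y ≤ y * Real.cosh y := by
  have hd (t : ℝ) :
      HasDerivAt (fun t => t * Real.cosh t - Real.sinh t) (t * Real.sinh t) t := by
    refine (((hasDerivAt_id' t).mul (Real.hasDerivAt_cosh t)).sub
      (Real.hasDerivAt_sinh t)).congr_deriv ?_
    ring
  have hmono : Monotone (fun t => t * Real.cosh t - Real.sinh t) := by
    refine monotone_of_deriv_nonneg (fun t => (hd t).differentiableAt) fun t => ?_
    rw [(hd t).deriv]
    rcases le_total 0 t with h | h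
    · exact mul_nonneg h (Real.sinh_nonneg_iff.2 h)
    · exact mul_nonneg_of_nonpos_of_nonpos h (Real.sinh_nonpos_iff.2 h)
  have := hmono hy
  simp only [Real.cosh_zero, Real.sinh_zero] at this
  linarith

theorem sinh_mul_cosh_le_of_le {x y : ℝ} (h : y ≤ x) :
    Real.sinh y * Real.cosh x ≤ Real.sinh x * Real.cosh y := by
  have := Real.sinh_nonneg_iff.2 (sub_nonneg.2 h)
  rw [Real.sinh_sub] at this
  linarith

/-- In the variable `x = log Λ / (2r)`, the equation for the expansion factor reads
`tanh x * tanh (r * x) = r ^ 2`. -/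
theorem sinh_mul_sinh_eq_of_expansion_eq {r x : ℝ} (hr : r ∈ Set.Ioo (0 : ℝ) 1)
    (h : -(Real.exp (2 * r * x)) ^ (1 + 1 / r) + ((1 + r ^ 2) / (1 - r ^ 2)) *
      ((Real.exp (2 * r * x)) ^ (1 / r) + Real.exp (2 * r * x)) - 1 = 0) :
    Real.sinh x * Real.sinh (r * x) = r ^ 2 * (Real.cosh x * Real.cosh (r * x)) := by
  have hr0 : r ≠ 0 := hr.1.ne'
  have hr1 : 1 - r ^ 2 ≠ 0 := by nlinarith [hr.1, hr.2]
  rw [← Real.exp_mul, ← Real.exp_mul,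
    show 2 * r * x * (1 + 1 / r) = x + x + (r * x + r * x) by field_simp; ring,
    show 2 * r * x * (1 / r) = x + x by field_simp; ring,
    show 2 * r * x = r * x + r * x by ring] at h
  simp only [Real.exp_add] at h
  simp only [Real.sinh_eq, Real.cosh_eq, Real.exp_neg]
  have ha := (Real.exp_pos x).ne'
  have hb := (Real.exp_pos (r * x)).ne'
  generalize Real.exp x = a at *
  generalize Real.exp (r * x) = b at *
  field_simp at h ⊢
  linarith

theorem sqrt_le_of_sinh_mul_sinh_eq {s x : ℝ} (hs : 0 < s) (hx : 0 < x)
    (h : Real.sinh x * Real.sinh (s ^ 2 * x) =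
      (s ^ 2) ^ 2 * (Real.cosh x * Real.cosh (s ^ 2 * x))) : s ≤ x := by
  have hy : 0 < s ^ 2 * x := by positivity
  have hmul := mul_le_mul (sinh_le_mul_cosh hx.le) (sinh_le_mul_cosh hy.le)
    (Real.sinh_nonneg_iff.2 hy.le) (mul_pos hx (Real.cosh_pos x)).le
  rw [h] at hmul
  have hc : 0 < s ^ 2 * (Real.cosh x * Real.cosh (s ^ 2 * x)) :=
    mul_pos (by positivity) (mul_pos (Real.cosh_pos _) (Real.cosh_pos _))
  have : s ^ 2 ≤ x ^ 2 := le_of_mul_le_mul_right (by linarith) hc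
  exact (sq_le_sq₀ hs.le hx.le).1 this

theorem le_sqrt_add_of_sinh_mul_sinh_eq {s x : ℝ} (hs : 0 < s) (hs1 : s ≤ 1 / 4)
    (h : Real.sinh x * Real.sinh (s ^ 2 * x) =
      (s ^ 2) ^ 2 * (Real.cosh x * Real.cosh (s ^ 2 * x))) : x ≤ s + s ^ 2 := by
  by_contra! hlt
  set z := s + s ^ 2 with hz
  have hz0 : 0 < z := by positivity
  have hw0 : 0 < s ^ 2 * z := by positivity
  have hcx := Real.cosh_pos x
  have hcy := Real.cosh_pos (s ^ 2 * x)
  have hyz : s ^ 2 * z ≤ s ^ 2 * x := by gcongr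
  have hmul := mul_le_mul (sinh_mul_cosh_le_of_le hlt.le) (sinh_mul_cosh_le_of_le hyz)
    (mul_nonneg (Real.sinh_nonneg_iff.2 hw0.le) hcy.le)
    (mul_nonneg (Real.sinh_nonneg_iff.2 (hz0.trans hlt).le) (Real.cosh_pos z).le)
  have hz_le : Real.sinh z * Real.sinh (s ^ 2 * z) ≤
      (s ^ 2) ^ 2 * (Real.cosh z * Real.cosh (s ^ 2 * z)) := by
    refine le_of_mul_le_mul_right ?_ (mul_pos hcx hcy)
    calc _ = _ := by ring
      _ ≤ _ := hmul
      _ = (Real.sinh x * Real.sinh (s ^ 2 * x)) * (Real.cosh z * Real.cosh (s ^ 2 * z)) := by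
        ring
      _ = _ := by rw [h]; ring
  have hsinh : z * (s ^ 2 * z) ≤ Real.sinh z * Real.sinh (s ^ 2 * z) :=
    mul_le_mul (Real.self_le_sinh_iff.2 hz0.le) (Real.self_le_sinh_iff.2 hw0.le) hw0.le
      (Real.sinh_nonneg_iff.2 hz0.le)
  have hcosh : Real.cosh z * Real.cosh (s ^ 2 * z) ≤ Real.exp (z ^ 2) := by
    calc _ ≤ Real.exp (z ^ 2 / 2) * Real.exp ((s ^ 2 * z) ^ 2 / 2) :=
        mul_le_mul (Real.cosh_le_exp_half_sq _) (Real.cosh_le_exp_half_sq _)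
          (Real.cosh_pos _).le (Real.exp_pos _).le
      _ = Real.exp (z ^ 2 / 2 + (s ^ 2 * z) ^ 2 / 2) := (Real.exp_add _ _).symm
      _ ≤ _ := by
        refine Real.exp_le_exp.2 ?_
        have : s ^ 2 * z ≤ z := mul_le_of_le_one_left hz0.le (by nlinarith)
        nlinarith [pow_le_pow_left₀ hw0.le this 2]
  have hexp : (1 - z ^ 2) * Real.exp (z ^ 2) ≤ 1 := by
    have := mul_le_mul_of_nonneg_right (Real.one_sub_le_exp_neg (z ^ 2)) (Real.exp_pos (z ^ 2)).le
    rwa [← Real.exp_add, neg_add_cancel, Real.exp_zero] at this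
  have hz2 : z ^ 2 ≤ s ^ 2 * (25 / 16) := by
    rw [hz]
    nlinarith [mul_pos (pow_pos hs 2) hs, mul_le_mul_of_nonneg_left hs1 (sq_nonneg s),
      mul_le_mul_of_nonneg_left hs1 (mul_pos (pow_pos hs 2) hs).le]
  have hz1 : 0 < 1 - z ^ 2 := by nlinarith
  have hle : z ^ 2 ≤ s ^ 2 * Real.exp (z ^ 2) := by
    refine le_of_mul_le_mul_left ?_ (pow_pos hs 2)
    nlinarith [mul_le_mul_of_nonneg_left hcosh (sq_nonneg (s ^ 2))]
  have hle2 : z ^ 2 * (1 - z ^ 2) ≤ s ^ 2 := by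
    nlinarith [mul_le_mul_of_nonneg_left hle hz1.le,
      mul_le_mul_of_nonneg_left hexp (sq_nonneg s)]
  have hle3 : (1 + s) ^ 2 * (1 - z ^ 2) ≤ 1 := by
    refine le_of_mul_le_mul_left ?_ (pow_pos hs 2)
    calc _ = z ^ 2 * (1 - z ^ 2) := by rw [hz]; ring
      _ ≤ _ := by linarith
  have : (1 + s) ^ 2 * (1 - s ^ 2 * (25 / 16)) ≤ 1 :=
    (mul_le_mul_of_nonneg_left (by linarith) (sq_nonneg _)).trans hle3
  nlinarith [mul_pos (pow_pos hs 2) hs, mul_le_mul_of_nonneg_left hs1 hs.le,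
    mul_le_mul_of_nonneg_left hs1 (sq_nonneg s),
    mul_le_mul_of_nonneg_left hs1 (mul_pos (pow_pos hs 2) hs).le]

/-- Asymptotics (5.4) of Theorem 5.1: if `Λ_r` is, for each `r ∈ (0,1)`, the unique
solution in `(1,∞)` of `−Λ^{1+1/r} + ((1+r²)/(1−r²))(Λ^{1/r} + Λ) − 1 = 0`, then
`Λ_r = 1 + c·r^{3/2} + O(r²)` as `r → 0⁺`, for some constant `c > 0`. -/
theorem expansion_factor_asymptotics_at_zero (L : ℝ → ℝ)
    (hL : ∀ r ∈ Set.Ioo (0:ℝ) 1,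
      1 < L r ∧
      (-(L r) ^ (1 + 1 / r) + ((1 + r ^ 2) / (1 - r ^ 2)) * ((L r) ^ (1 / r) + L r)
        - 1 = 0) ∧
      ∀ Λ : ℝ, 1 < Λ →
        (-Λ ^ (1 + 1 / r) + ((1 + r ^ 2) / (1 - r ^ 2)) * (Λ ^ (1 / r) + Λ) - 1 = 0) →
        Λ = L r) :
    ∃ c : ℝ, 0 < c ∧
      (fun r : ℝ => L r - 1 - c * r ^ ((3:ℝ) / 2)) =O[nhdsWithin 0 (Set.Ioi 0)]
        (fun r : ℝ => r ^ 2) := by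
  refine ⟨2, two_pos, IsBigO.of_bound 6 ?_⟩
  filter_upwards [Ioo_mem_nhdsGT (show (0 : ℝ) < 1 / 16 by norm_num)] with r hr
  have hr' : r ∈ Set.Ioo (0 : ℝ) 1 := ⟨hr.1, hr.2.trans (by norm_num)⟩
  obtain ⟨hL1, heq, -⟩ := hL r hr'
  obtain ⟨s, hs, hrs⟩ : ∃ s : ℝ, 0 < s ∧ r = s ^ 2 :=
    ⟨√r, Real.sqrt_pos.2 hr.1, (Real.sq_sqrt hr.1.le).symm⟩
  have hs1 : s ≤ 1 / 4 := by nlinarith [hr.2]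
  obtain ⟨x, hx, hLx⟩ : ∃ x : ℝ, 0 < x ∧ L r = Real.exp (2 * r * x) := by
    refine ⟨Real.log (L r) / (2 * r), div_pos (Real.log_pos hL1) (by linarith [hr.1]), ?_⟩
    rw [mul_div_cancel₀ _ (by linarith [hr.1]), Real.exp_log (by linarith)]
  rw [hLx] at heq
  have hsinh := sinh_mul_sinh_eq_of_expansion_eq hr' heq
  have hpow : r ^ ((3 : ℝ) / 2) = s ^ 3 := by
    rw [hrs, ← Real.rpow_natCast, ← Real.rpow_natCast, ← Real.rpow_mul hs.le]
    norm_num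
  rw [hpow, hLx]
  clear hpow hLx heq
  subst hrs
  have hlow := sqrt_le_of_sinh_mul_sinh_eq hs hx hsinh
  have hup := le_sqrt_add_of_sinh_mul_sinh_eq hs hs1 hsinh
  have hx1 : x ≤ 1 := by nlinarith
  have hy0 : 0 < 2 * s ^ 2 * x := by positivity
  have hy1 : 2 * s ^ 2 * x ≤ 1 := by nlinarith
  have hexp_low := Real.add_one_le_exp (2 * s ^ 2 * x)
  have hexp_up := Real.norm_exp_sub_one_sub_id_le
    (show ‖2 * s ^ 2 * x‖ ≤ 1 by rwa [Real.norm_of_nonneg hy0.le])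
  rw [Real.norm_of_nonneg hy0.le] at hexp_up
  have hexp_up' := (le_abs_self _).trans hexp_up
  have hxs : s ^ 2 * s ≤ s ^ 2 * x := by gcongr
  have hxs' : s ^ 2 * x ≤ s ^ 2 * (s + s ^ 2) := by gcongr
  have hsq : (2 * s ^ 2 * x) ^ 2 ≤ 4 * s ^ 4 := by
    calc _ = 4 * s ^ 4 * x ^ 2 := by ring
      _ ≤ 4 * s ^ 4 * 1 := by gcongr; nlinarith
      _ = _ := by ring
  rw [Real.norm_of_nonneg (by nlinarith), Real.norm_of_nonneg (by positivity)]
  nlinarith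
end

section
/- Let Λ_r denote, for r ∈ (0,1), the unique solution in (1,∞) of −Λ^{1+1/r} + ((1+r²)/(1−r²))·(Λ^{1/r} + Λ) − 1 = 0. Then there is a constant c > 0 such that (1−r)·Λ_r → c as r → 1⁻; that is, Λ_r ∼ c/(1−r) as r → 1. -/
open Set Filter

/-- Rescaled fixed-point form of the dispersion relation for the expansion factor. -/
theorem one_sub_mul_eq_of_expansion_equation {r x : ℝ} (hr : r ∈ Ioo (0 : ℝ) 1) (hx : 1 < x)
    (h : -x ^ (1 + 1 / r) + ((1 + r ^ 2) / (1 - r ^ 2)) * (x ^ (1 / r) + x) - 1 = 0) :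
    (1 - r) * x = (1 + r ^ 2) / (1 + r) * (1 + x ^ (1 - 1 / r)) - (1 - r) * x ^ (-(1 / r)) := by
  obtain ⟨h0, h1⟩ := hr
  have hx0 : 0 < x := by linarith
  have hp : 0 < x ^ (1 / r) := Real.rpow_pos_of_pos hx0 _
  rw [Real.rpow_add hx0, Real.rpow_one] at h
  rw [Real.rpow_sub hx0, Real.rpow_one, Real.rpow_neg hx0.le]
  generalize x ^ (1 / r) = p at *
  have hr1 : 1 - r ≠ 0 := by linarith
  have hr2 : 1 + r ≠ 0 := by linarith
  have hK : (1 + r ^ 2) / (1 - r ^ 2) = (1 + r ^ 2) / (1 + r) / (1 - r) := by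
    rw [div_div]; congr 1; ring
  rw [hK] at h
  generalize (1 + r ^ 2) / (1 + r) = k at *
  field_simp at h ⊢
  linear_combination -h

/-- The logarithm of a solution of the dispersion relation grows more slowly than `1 / (1 - r)`. -/
theorem one_sub_mul_log_le_of_expansion_equation {r x : ℝ} (hr : r ∈ Ioo (0 : ℝ) 1) (hx : 1 < x)
    (h : -x ^ (1 + 1 / r) + ((1 + r ^ 2) / (1 - r ^ 2)) * (x ^ (1 / r) + x) - 1 = 0) :
    (1 - r) * Real.log x ≤ 4 * √(1 - r) := by
  have heq := one_sub_mul_eq_of_expansion_equation hr hx h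
  obtain ⟨h0, h1⟩ := hr
  have hx0 : 0 < x := by linarith
  have hs : 1 < 1 / r := by rw [lt_div_iff₀ h0]; linarith
  have hle : x ^ (1 - 1 / r) ≤ 1 := Real.rpow_le_one_of_one_le_of_nonpos hx.le (by linarith)
  have hpos : 0 < x ^ (1 - 1 / r) := Real.rpow_pos_of_pos hx0 _
  have hneg : 0 ≤ (1 - r) * x ^ (-(1 / r)) :=
    mul_nonneg (by linarith) (Real.rpow_nonneg hx0.le _)
  have hk : (1 + r ^ 2) / (1 + r) ≤ 1 := by rw [div_le_one (by linarith)]; nlinarith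
  have hu : (1 - r) * x ≤ 4 := by nlinarith
  have hlog : Real.log x ≤ 2 * √x := by
    have := Real.log_le_sub_one_of_pos (Real.sqrt_pos.2 hx0)
    rw [Real.log_sqrt hx0.le] at this
    linarith
  have hsq : √(1 - r) * √x ≤ 2 := by
    rw [← Real.sqrt_mul (by linarith)]
    exact Real.sqrt_le_iff.2 ⟨by norm_num, by linarith⟩
  calc (1 - r) * Real.log x ≤ (1 - r) * (2 * √x) := by gcongr
    _ = 2 * √(1 - r) * (√(1 - r) * √x) := by
      linear_combination (-2 * √x) * Real.mul_self_sqrt (by linarith : (0 : ℝ) ≤ 1 - r)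
    _ ≤ 2 * √(1 - r) * 2 := by gcongr
    _ = 4 * √(1 - r) := by ring

/-- Asymptotics (5.5) of Theorem 5.1: if `Λ_r` is, for each `r ∈ (0,1)`, the unique
solution in `(1,∞)` of `−Λ^{1+1/r} + ((1+r²)/(1−r²))(Λ^{1/r} + Λ) − 1 = 0`, then
`Λ_r ∼ c/(1−r)` as `r → 1⁻`, i.e. `(1−r)·Λ_r → c` for some constant `c > 0`. -/
theorem expansion_factor_asymptotics_at_one (L : ℝ → ℝ)
    (hL : ∀ r ∈ Set.Ioo (0:ℝ) 1,
      1 < L r ∧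
      (-(L r) ^ (1 + 1 / r) + ((1 + r ^ 2) / (1 - r ^ 2)) * ((L r) ^ (1 / r) + L r)
        - 1 = 0) ∧
      ∀ Λ : ℝ, 1 < Λ →
        (-Λ ^ (1 + 1 / r) + ((1 + r ^ 2) / (1 - r ^ 2)) * (Λ ^ (1 / r) + Λ) - 1 = 0) →
        Λ = L r) :
    ∃ c : ℝ, 0 < c ∧
      Filter.Tendsto (fun r : ℝ => (1 - r) * L r) (nhdsWithin 1 (Set.Iio 1))
        (nhds c) := by
  have hmem : ∀ᶠ r : ℝ in nhdsWithin 1 (Iio 1), r ∈ Ioo (0 : ℝ) 1 :=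
    Ioo_mem_nhdsLT one_pos
  have hid : Tendsto (fun r : ℝ => r) (nhdsWithin 1 (Iio 1)) (nhds 1) :=
    tendsto_id.mono_left nhdsWithin_le_nhds
  have hsub : Tendsto (fun r : ℝ => 1 - r) (nhdsWithin 1 (Iio 1)) (nhds 0) := by
    simpa using hid.const_sub 1
  have hlog : Tendsto (fun r => (1 - r) * Real.log (L r)) (nhdsWithin 1 (Iio 1)) (nhds 0) := by
    have hsqrt : Tendsto (fun r : ℝ => 4 * √(1 - r)) (nhdsWithin 1 (Iio 1)) (nhds 0) := by
      simpa using hsub.sqrt.const_mul 4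
    refine squeeze_zero' ?_ ?_ hsqrt
    · filter_upwards [hmem] with r hr
      exact mul_nonneg (by linarith [hr.2]) (Real.log_nonneg (hL r hr).1.le)
    · filter_upwards [hmem] with r hr
      exact one_sub_mul_log_le_of_expansion_equation hr (hL r hr).1 (hL r hr).2.1
  have hpow : Tendsto (fun r => L r ^ (1 - 1 / r)) (nhdsWithin 1 (Iio 1)) (nhds 1) := by
    have hexp := (Real.continuous_exp.tendsto _).comp (hlog.div hid one_ne_zero).neg
    simp only [zero_div, neg_zero, Real.exp_zero] at hexp
    refine hexp.congr' ?_
    filter_upwards [hmem] with r hr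
    have hr0 : r ≠ 0 := hr.1.ne'
    rw [Real.rpow_def_of_pos (by linarith [(hL r hr).1]), Function.comp_apply]
    congr 1
    simp only [Pi.div_apply]
    field_simp
    ring
  have hrem : Tendsto (fun r => (1 - r) * L r ^ (-(1 / r))) (nhdsWithin 1 (Iio 1)) (nhds 0) := by
    refine squeeze_zero' ?_ ?_ hsub
    · filter_upwards [hmem] with r hr
      exact mul_nonneg (by linarith [hr.2]) (Real.rpow_nonneg (by linarith [(hL r hr).1]) _)
    · filter_upwards [hmem] with r hr
      have hp : 0 < 1 / r := one_div_pos.2 hr.1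
      exact mul_le_of_le_one_right (by linarith [hr.2])
        (Real.rpow_le_one_of_one_le_of_nonpos (hL r hr).1.le (by linarith))
  have hk : Tendsto (fun r : ℝ => (1 + r ^ 2) / (1 + r)) (nhdsWithin 1 (Iio 1)) (nhds 1) := by
    have := ((hid.pow 2).const_add 1).div (hid.const_add 1) (by norm_num)
    norm_num at this
    exact this
  have hlim := (hk.mul (hpow.const_add 1)).sub hrem
  refine ⟨2, two_pos, ?_⟩
  norm_num only at hlim
  refine hlim.congr' ?_
  filter_upwards [hmem] with r hr
  exact (one_sub_mul_eq_of_expansion_equation hr (hL r hr).1 (hL r hr).2.1).symm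
end

section
/- Let ω > 0, and let ρ : (0,∞) → ℝ be a nonnegative, continuously differentiable, nonincreasing function (ρ′ ≤ 0) with ρ′(v) = 0 for 0 < v ≤ ω/(2π), such that ρ, v²ρ, and v²ρ′ are integrable on (0,∞), v·ρ(v) → 0 and v³·ρ(v) → 0 as v → ∞, and M = ∫₀^∞ ρ(v) dv > 0. Set K = ∫₀^∞ ρ(v)·v²/2 dv and ⟨K⟩ = K/M. Suppose the constraint ∫_{ω/2π}^∞ ρ′(v)·v²·sin(ω/v)/(1−cos(ω/v)) dv = 0 holds (the integral converging absolutely). Then the period T = 2π/ω satisfies T ≥ √(2/(3⟨K⟩)), with equality exactly when −ρ′ is a point mass of weight π/ω at v = ω/π (i.e. ρ is constant on (0, ω/π) and 0 beyond). -/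
open Set MeasureTheory Filter Real
open scoped Topology

/-- The derivative of `(π² - 4x²) sin x - 8x cos x` factors. -/
lemma hasDerivAt_sin_cos_gap (x : ℝ) :
    HasDerivAt (fun x : ℝ => (π ^ 2 - 4 * x ^ 2) * sin x - 8 * x * cos x)
      ((π ^ 2 - 8 - 4 * x ^ 2) * cos x) x := by
  have h1 : HasDerivAt (fun x : ℝ => π ^ 2 - 4 * x ^ 2) (-(8 * x)) x := by
    refine (((hasDerivAt_pow 2 x).const_mul 4).const_sub (π ^ 2)).congr_deriv ?_
    norm_num
    ring
  have h2 : HasDerivAt (fun x : ℝ => 8 * x) 8 x := by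
    simpa using (hasDerivAt_id x).const_mul (8 : ℝ)
  refine ((h1.mul (hasDerivAt_sin x)).sub (h2.mul (hasDerivAt_cos x))).congr_deriv ?_
  ring

lemma sin_cos_gap_pos {x : ℝ} (h0 : 0 < x) (hπ : x < π) (hne : x ≠ π / 2) :
    0 < (π ^ 2 - 4 * x ^ 2) * sin x - 8 * x * cos x := by
  set f : ℝ → ℝ := fun x => (π ^ 2 - 4 * x ^ 2) * sin x - 8 * x * cos x with hf
  change 0 < f x
  have hd : ∀ y, HasDerivAt f ((π ^ 2 - 8 - 4 * y ^ 2) * cos y) y := hasDerivAt_sin_cos_gap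
  have hc : Continuous f := continuous_iff_continuousAt.2 fun y => (hd y).continuousAt
  have hf0 : f 0 = 0 := by simp [hf]
  have hf2 : f (π / 2) = 0 := by simp [hf]; ring
  have h3 := pi_gt_three
  rcases lt_or_gt_of_ne hne with hx | hx
  · rcases le_or_gt (4 * x ^ 2) (π ^ 2 - 8) with hx2 | hx2
    · have hmono : StrictMonoOn f (Icc 0 x) := by
        apply strictMonoOn_of_deriv_pos (convex_Icc _ _) hc.continuousOn
        intro y hy
        rw [interior_Icc] at hy
        rw [(hd y).deriv]
        apply mul_pos
        · nlinarith [hy.1, hy.2]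
        · exact cos_pos_of_mem_Ioo ⟨by linarith [hy.1], by linarith [hy.2]⟩
      have := hmono (left_mem_Icc.2 h0.le) (right_mem_Icc.2 h0.le) h0
      rwa [hf0] at this
    · have hanti : StrictAntiOn f (Icc x (π / 2)) := by
        apply strictAntiOn_of_deriv_neg (convex_Icc _ _) hc.continuousOn
        intro y hy
        rw [interior_Icc] at hy
        rw [(hd y).deriv]
        apply mul_neg_of_neg_of_pos
        · nlinarith [hy.1, hy.2]
        · exact cos_pos_of_mem_Ioo ⟨by linarith [hy.1], by linarith [hy.2]⟩
      have := hanti (left_mem_Icc.2 hx.le) (right_mem_Icc.2 hx.le) hx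
      rwa [hf2] at this
  · have hmono : StrictMonoOn f (Icc (π / 2) x) := by
      apply strictMonoOn_of_deriv_pos (convex_Icc _ _) hc.continuousOn
      intro y hy
      rw [interior_Icc] at hy
      rw [(hd y).deriv]
      apply mul_pos_of_neg_of_neg
      · nlinarith [hy.1, hy.2]
      · exact cos_neg_of_pi_div_two_lt_of_lt hy.1 (by linarith [hy.2])
    have := hmono (left_mem_Icc.2 hx.le) (right_mem_Icc.2 hx.le) hx
    rwa [hf2] at this

/-- In the speed variable `v = ω / (2x)`, the weight tested against `-ρ'` is positive away
from `ω / π`. -/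
lemma weight_pos {ω v : ℝ} (hω : 0 < ω) (hv : ω / (2 * π) < v) (hne : v ≠ ω / π) :
    0 < v ^ 3 - (ω / π) ^ 2 * v
      - 4 * ω / π ^ 2 * (v ^ 2 * sin (ω / v) / (1 - cos (ω / v))) := by
  have hv0 : 0 < v := lt_trans (by positivity) hv
  have hπ := pi_pos
  obtain ⟨x, hx⟩ : ∃ x, x = ω / (2 * v) := ⟨_, rfl⟩
  have hx0 : 0 < x := by rw [hx]; positivity
  have hω' : ω = 2 * v * x := by rw [hx]; field_simp
  have hxπ : x < π := by
    rw [hx, div_lt_iff₀ (by positivity)]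
    rw [div_lt_iff₀ (by positivity)] at hv
    linarith
  have hx2 : x ≠ π / 2 := by
    rintro rfl
    apply hne
    rw [hω']
    field_simp
  have hs : 0 < sin x := sin_pos_of_pos_of_lt_pi hx0 hxπ
  have hωv : ω / v = 2 * x := by rw [hω']; field_simp
  have hcs : 1 - cos (2 * x) = 2 * sin x ^ 2 := by rw [cos_two_mul, cos_sq']; ring
  rw [hωv, sin_two_mul, hcs, hω']
  have key := sin_cos_gap_pos hx0 hxπ hx2
  have : v ^ 3 - (2 * v * x / π) ^ 2 * v
      - 4 * (2 * v * x) / π ^ 2 * (v ^ 2 * (2 * sin x * cos x) / (2 * sin x ^ 2))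
      = v ^ 3 / (π ^ 2 * sin x) * ((π ^ 2 - 4 * x ^ 2) * sin x - 8 * x * cos x) := by
    field_simp
    ring
  rw [this]
  positivity

/-- Integration by parts for moments of a nonincreasing profile that is constant near `0`. -/
lemma moment_identity {ρ ρ' : ℝ → ℝ} {a : ℝ} (ha : 0 < a) (n : ℕ)
    (hderiv : ∀ v ∈ Ioi (0 : ℝ), HasDerivAt ρ (ρ' v) v)
    (hnonpos : ∀ v ∈ Ioi (0 : ℝ), ρ' v ≤ 0)
    (hflat : ∀ v : ℝ, 0 < v → v ≤ a → ρ' v = 0)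
    (hint : IntegrableOn (fun v => v ^ n * ρ v) (Ioi 0))
    (hlim : Tendsto (fun v => v ^ (n + 1) * ρ v) atTop (𝓝 0)) :
    IntegrableOn (fun v => v ^ (n + 1) * ρ' v) (Ioi a) ∧
      ∫ v in Ioi a, v ^ (n + 1) * ρ' v = -((n + 1) * ∫ v in Ioi (0 : ℝ), v ^ n * ρ v) := by
  have hconst : ∀ v ∈ Ioc 0 a, ρ v = ρ a := by
    intro v hv
    have hd : ∀ x ∈ Icc v a, HasDerivAt ρ (ρ' x) x := fun x hx => hderiv x (hv.1.trans_le hx.1)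
    refine (constant_of_has_deriv_right_zero (f := ρ) (a := v) (b := a)
      (fun x hx => (hd x hx).continuousAt.continuousWithinAt) (fun x hx => ?_)
      a (right_mem_Icc.2 hv.2)).symm
    have := hd x (Ico_subset_Icc_self hx)
    rw [hflat x (hv.1.trans_le hx.1) hx.2.le] at this
    exact this.hasDerivWithinAt
  have hcont : ContinuousOn (fun v => v ^ n * ρ v) (Ioi 0) := fun v hv =>
    ((continuous_pow n).continuousAt.mul (hderiv v hv).continuousAt).continuousWithinAt
  have hinta : IntegrableOn (fun v => v ^ n * ρ v) (Ioi a) :=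
    hint.mono_set (Ioi_subset_Ioi ha.le)
  set F : ℝ → ℝ := fun v => v ^ (n + 1) * ρ v - (n + 1) * ∫ t in a..v, t ^ n * ρ t with hF
  have hFd : ∀ v ∈ Ioi (0 : ℝ), HasDerivAt F (v ^ (n + 1) * ρ' v) v := by
    intro v hv
    have h1 := (hasDerivAt_pow (n + 1) v).mul (hderiv v hv)
    have hii : IntervalIntegrable (fun t => t ^ n * ρ t) volume a v := by
      apply ContinuousOn.intervalIntegrable
      exact hcont.mono fun t ht => lt_of_lt_of_le (lt_min ha hv) ht.1
    have h2 := intervalIntegral.integral_hasDerivAt_right hii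
      (hcont.stronglyMeasurableAtFilter isOpen_Ioi v hv)
      (hcont.continuousAt (isOpen_Ioi.mem_nhds hv))
    refine (h1.sub (h2.const_mul ((n : ℝ) + 1))).congr_deriv ?_
    simp only [Nat.add_sub_cancel, Nat.cast_add, Nat.cast_one]
    ring
  have hFlim : Tendsto F atTop (𝓝 (0 - (n + 1) * ∫ t in Ioi a, t ^ n * ρ t)) :=
    hlim.sub ((intervalIntegral_tendsto_integral_Ioi a hinta tendsto_id).const_mul _)
  have hcw : ContinuousWithinAt F (Ici a) a := (hFd a ha).continuousAt.continuousWithinAt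
  have hnp : ∀ v ∈ Ioi a, v ^ (n + 1) * ρ' v ≤ 0 := fun v hv =>
    mul_nonpos_of_nonneg_of_nonpos (pow_nonneg (ha.trans hv).le _) (hnonpos v (ha.trans hv))
  refine ⟨integrableOn_Ioi_deriv_of_nonpos hcw (fun v hv => hFd v (ha.trans hv)) hnp hFlim, ?_⟩
  rw [integral_Ioi_of_hasDerivAt_of_nonpos hcw (fun v hv => hFd v (ha.trans hv)) hnp hFlim]
  have hsplit : ∫ v in Ioi (0 : ℝ), v ^ n * ρ v
      = (∫ v in Ioc 0 a, v ^ n * ρ v) + ∫ v in Ioi a, v ^ n * ρ v := by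
    rw [← Ioc_union_Ioi_eq_Ioi ha.le]
    exact setIntegral_union (Ioc_disjoint_Ioi le_rfl) measurableSet_Ioi
      (hint.mono_set Ioc_subset_Ioi_self) hinta
  have hnear : ∫ v in Ioc 0 a, v ^ n * ρ v = a ^ (n + 1) / (n + 1) * ρ a := by
    rw [setIntegral_congr_fun (g := fun v => v ^ n * ρ a) measurableSet_Ioc
      (fun v hv => by simp only [hconst v hv]), ← intervalIntegral.integral_of_le ha.le,
      intervalIntegral.integral_mul_const, integral_pow]
    simp
  rw [hsplit, hnear, hF]
  have : (n : ℝ) + 1 ≠ 0 := by positivity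
  simp only [intervalIntegral.integral_same]
  field_simp
  ring

/-- Proposition 6.1: for a nonincreasing `C¹` gas density profile `ρ` compatible
(via the constraint `∫ ρ′(v) v² sin(ω/v)/(1−cos(ω/v)) dv = 0`) with harmonic
oscillations of the piston of frequency `ω`, the period `T = 2π/ω` satisfies
`T ≥ √(2/(3⟨K⟩))` where `⟨K⟩ = K/M`, with equality exactly when `ρ` is constant
on `(0, ω/π)` and `0` beyond. -/
theorem period_lower_bound (ω : ℝ) (hω : 0 < ω)
    (ρ ρ' : ℝ → ℝ)
    (hderiv : ∀ v ∈ Set.Ioi (0:ℝ), HasDerivAt ρ (ρ' v) v)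
    (hcont : ContinuousOn ρ' (Set.Ioi 0))
    (hρnonneg : ∀ v ∈ Set.Ioi (0:ℝ), 0 ≤ ρ v)
    (hρ'nonpos : ∀ v ∈ Set.Ioi (0:ℝ), ρ' v ≤ 0)
    (hflat : ∀ v : ℝ, 0 < v → v ≤ ω / (2 * π) → ρ' v = 0)
    (hint1 : IntegrableOn ρ (Set.Ioi 0))
    (hint2 : IntegrableOn (fun v => v ^ 2 * ρ v) (Set.Ioi 0))
    (hint3 : IntegrableOn (fun v => v ^ 2 * ρ' v) (Set.Ioi 0))
    (hlim1 : Tendsto (fun v => v * ρ v) atTop (nhds 0))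
    (hlim3 : Tendsto (fun v => v ^ 3 * ρ v) atTop (nhds 0))
    (M K : ℝ)
    (hM : M = ∫ v in Set.Ioi (0:ℝ), ρ v) (hMpos : 0 < M)
    (hK : K = ∫ v in Set.Ioi (0:ℝ), ρ v * v ^ 2 / 2)
    (hconstraint_int : IntegrableOn
      (fun v => ρ' v * v ^ 2 * Real.sin (ω / v) / (1 - Real.cos (ω / v)))
      (Set.Ioi (ω / (2 * π))))
    (hconstraint : ∫ v in Set.Ioi (ω / (2 * π)),
      ρ' v * v ^ 2 * Real.sin (ω / v) / (1 - Real.cos (ω / v)) = 0) :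
    Real.sqrt (2 / (3 * (K / M))) ≤ 2 * π / ω ∧
    (2 * π / ω = Real.sqrt (2 / (3 * (K / M))) ↔
      ((∃ c : ℝ, ∀ v ∈ Set.Ioo (0:ℝ) (ω / π), ρ v = c) ∧
        ∀ v ∈ Set.Ioi (ω / π), ρ v = 0)) := by
  have hπ := pi_pos
  set a := ω / (2 * π) with ha_def
  have ha : 0 < a := by positivity
  obtain ⟨hi1, he1⟩ := moment_identity ha 0 hderiv hρ'nonpos hflat (by simpa using hint1)
    (by simpa using hlim1)
  obtain ⟨hi3, he3⟩ := moment_identity ha 2 hderiv hρ'nonpos hflat hint2 hlim3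
  have hM' : ∫ v in Ioi a, v ^ (0 + 1) * ρ' v = -M := by
    rw [he1, hM]; simp
  have hK' : ∫ v in Ioi a, v ^ (2 + 1) * ρ' v = -(6 * K) := by
    have : K = (∫ v in Ioi (0 : ℝ), v ^ 2 * ρ v) / 2 := by
      rw [hK, ← integral_div]
      simp only [mul_comm]
    rw [he3, this]; push_cast; ring
  have hne_ae : ∀ᵐ v ∂(volume.restrict (Ioi a)), v ≠ ω / π :=
    ae_restrict_of_ae (Measure.ae_ne volume (ω / π))
  have hnot_zero : ¬ ∀ᵐ v ∂(volume.restrict (Ioi a)), ρ' v = 0 := by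
    intro h
    have : ∫ v in Ioi a, v ^ (0 + 1) * ρ' v = 0 :=
      integral_eq_zero_of_ae (by filter_upwards [h] with v hv; simp [hv])
    linarith
  set G : ℝ → ℝ := fun v => -(v ^ (2 + 1) * ρ' v) + (ω / π) ^ 2 * (v ^ (0 + 1) * ρ' v)
    + 4 * ω / π ^ 2 * (ρ' v * v ^ 2 * sin (ω / v) / (1 - cos (ω / v))) with hG
  have hGeq : ∀ v, G v = -ρ' v * (v ^ 3 - (ω / π) ^ 2 * v
      - 4 * ω / π ^ 2 * (v ^ 2 * sin (ω / v) / (1 - cos (ω / v)))) := by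
    intro v; simp only [hG]; ring
  have hGint : IntegrableOn G (Ioi a) :=
    (hi3.neg.add (hi1.const_mul _)).add (hconstraint_int.const_mul _)
  have hGval : ∫ v in Ioi a, G v = 6 * K - (ω / π) ^ 2 * M := by
    have h := integral_add (hi3.neg.add (hi1.const_mul ((ω / π) ^ 2)))
      (hconstraint_int.const_mul (4 * ω / π ^ 2))
    have h' := integral_add hi3.neg (hi1.const_mul ((ω / π) ^ 2))
    simp only [Pi.add_apply, Pi.neg_apply] at h h'
    rw [h, h', integral_neg, integral_const_mul, integral_const_mul, hconstraint, hM', hK']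
    ring
  have hGnonneg : 0 ≤ᵐ[volume.restrict (Ioi a)] G := by
    filter_upwards [hne_ae, ae_restrict_mem measurableSet_Ioi] with v hne hv
    rw [hGeq]
    exact mul_nonneg (neg_nonneg.2 (hρ'nonpos v (ha.trans hv))) (weight_pos hω hv hne).le
  have hGpos : 0 < ∫ v in Ioi a, G v := by
    refine (integral_nonneg_of_ae hGnonneg).lt_of_ne fun h => hnot_zero ?_
    filter_upwards [(integral_eq_zero_iff_of_nonneg_ae hGnonneg hGint).1 h.symm, hne_ae,
      ae_restrict_mem measurableSet_Ioi] with v h0 hne hv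
    rw [hGeq] at h0
    simpa using (mul_eq_zero.1 h0).resolve_right (weight_pos hω hv hne).ne'
  rw [hGval, div_pow] at hGpos
  have hKM : ω ^ 2 * M < 6 * K * π ^ 2 := by
    have : ω ^ 2 / π ^ 2 * M < 6 * K := by linarith
    rwa [div_mul_eq_mul_div, div_lt_iff₀ (by positivity)] at this
  have hKpos : 0 < K := by
    have : 0 < ω ^ 2 / π ^ 2 * M := by positivity
    linarith
  have hlt : sqrt (2 / (3 * (K / M))) < 2 * π / ω := by
    rw [sqrt_lt' (by positivity), div_pow, div_lt_div_iff₀ (by positivity) (by positivity)]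
    have : (2 * π) ^ 2 * (3 * (K / M)) = 2 * (6 * K * π ^ 2) / M := by ring
    rw [this, lt_div_iff₀ hMpos]
    linarith
  refine ⟨hlt.le, fun h => absurd h hlt.ne', ?_⟩
  rintro ⟨⟨c, hc⟩, h0⟩
  refine absurd ?_ hnot_zero
  filter_upwards [hne_ae, ae_restrict_mem measurableSet_Ioi] with v hne hv
  have hv0 : 0 < v := ha.trans hv
  rcases lt_or_gt_of_ne hne with h | h
  · have : ρ =ᶠ[𝓝 v] fun _ => c := by
      filter_upwards [Ioo_mem_nhds hv0 h] with x hx using hc x hx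
    exact (hderiv v hv0).unique ((hasDerivAt_const v c).congr_of_eventuallyEq this)
  · have : ρ =ᶠ[𝓝 v] fun _ => 0 := by
      filter_upwards [Ioi_mem_nhds h] with x hx using h0 x hx
    exact (hderiv v hv0).unique ((hasDerivAt_const v 0).congr_of_eventuallyEq this)
end

section
/- Let ω > 0 and define G(v) = v·sin(ω/v)/(1 − cos(ω/v)) for v > ω/(2π). Then G is strictly increasing on (ω/(2π), ∞), G(ω/π) = 0, G(v) → −∞ as v → (ω/(2π))⁺, and G(v) → +∞ as v → +∞. In particular G(v) < 0 for v ∈ (ω/(2π), ω/π) and G(v) > 0 for v > ω/π. -/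
open Set Filter Real
open scoped Topology

/-- The function `cos u / (u sin u)` is strictly decreasing on `(0, π)`. -/
theorem strictAntiOn_cos_div_mul_sin :
    StrictAntiOn (fun u : ℝ => Real.cos u / (u * Real.sin u)) (Set.Ioo 0 π) := by
  have hne : ∀ u ∈ Set.Ioo 0 π, u * Real.sin u ≠ 0 := fun u hu =>
    (mul_pos hu.1 (Real.sin_pos_of_mem_Ioo hu)).ne'
  refine strictAntiOn_of_hasDerivWithinAt_neg
    (f' := fun u => (-Real.sin u * (u * Real.sin u) -
      Real.cos u * (1 * Real.sin u + u * Real.cos u)) / (u * Real.sin u) ^ 2)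
    (convex_Ioo 0 π) ?_ ?_ ?_
  · exact Real.continuous_cos.continuousOn.div
      (continuous_id.mul Real.continuous_sin).continuousOn hne
  · rw [interior_Ioo]
    intro u hu
    exact ((Real.hasDerivAt_cos u).div ((hasDerivAt_id' u).mul (Real.hasDerivAt_sin u))
      (hne u hu)).hasDerivWithinAt
  · rw [interior_Ioo]
    intro u hu
    refine div_neg_of_neg_of_pos ?_ (pow_pos (mul_pos hu.1 (Real.sin_pos_of_mem_Ioo hu)) 2)
    have hs := Real.sin_pos_of_mem_Ioo hu
    have hlt := Real.sin_lt hu.1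
    have hc := mul_nonneg hs.le (by linarith [Real.neg_one_le_cos u] : 0 ≤ Real.cos u + 1)
    linear_combination hlt + hc + u * Real.sin_sq_add_cos_sq u * (-1)

/-- The function `cos u / (u sin u)` tends to `+∞` as `u → 0⁺`. -/
theorem tendsto_cos_div_mul_sin_zero :
    Tendsto (fun u : ℝ => Real.cos u / (u * Real.sin u)) (𝓝[>] 0) atTop := by
  have hcos : Tendsto Real.cos (𝓝[>] 0) (𝓝 1) := by
    simpa using (Real.continuous_cos.tendsto 0).mono_left nhdsWithin_le_nhds
  have hden : Tendsto (fun u : ℝ => u * Real.sin u) (𝓝[>] 0) (𝓝[>] 0) := by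
    refine tendsto_nhdsWithin_iff.2 ⟨?_, ?_⟩
    · simpa using ((by fun_prop : Continuous fun u : ℝ => u * Real.sin u).tendsto 0).mono_left
        nhdsWithin_le_nhds
    · filter_upwards [Ioo_mem_nhdsGT Real.pi_pos] with u hu
      exact mul_pos hu.1 (Real.sin_pos_of_mem_Ioo hu)
  simpa only [div_eq_mul_inv, Function.comp_def] using
    hcos.pos_mul_atTop one_pos (tendsto_inv_nhdsGT_zero.comp hden)

/-- The function `cos u / (u sin u)` tends to `-∞` as `u → π⁻`. -/
theorem tendsto_cos_div_mul_sin_pi :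
    Tendsto (fun u : ℝ => Real.cos u / (u * Real.sin u)) (𝓝[<] π) atBot := by
  have hcos : Tendsto Real.cos (𝓝[<] π) (𝓝 (-1)) := by
    simpa using (Real.continuous_cos.tendsto π).mono_left nhdsWithin_le_nhds
  have hden : Tendsto (fun u : ℝ => u * Real.sin u) (𝓝[<] π) (𝓝[>] 0) := by
    refine tendsto_nhdsWithin_iff.2 ⟨?_, ?_⟩
    · simpa using ((by fun_prop : Continuous fun u : ℝ => u * Real.sin u).tendsto π).mono_left
        nhdsWithin_le_nhds
    · filter_upwards [Ioo_mem_nhdsLT Real.pi_pos] with u hu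
      exact mul_pos hu.1 (Real.sin_pos_of_mem_Ioo hu)
  simpa only [div_eq_mul_inv, Function.comp_def] using
    hcos.neg_mul_atTop (by norm_num) (tendsto_inv_nhdsGT_zero.comp hden)

/-- The half-angle form of `v sin(ω/v) / (1 - cos(ω/v))`. -/
theorem mul_sin_div_one_sub_cos_eq {ω : ℝ} (hω : ω ≠ 0) (v : ℝ) :
    v * Real.sin (ω / v) / (1 - Real.cos (ω / v)) =
      ω / 2 * (Real.cos (ω / 2 / v) / (ω / 2 / v * Real.sin (ω / 2 / v))) := by
  rcases eq_or_ne v 0 with rfl | hv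
  · simp
  have h2 : ω / v = 2 * (ω / 2 / v) := by ring
  have hcos : 1 - Real.cos (2 * (ω / 2 / v)) = 2 * Real.sin (ω / 2 / v) ^ 2 := by
    rw [Real.cos_two_mul, Real.cos_sq']
    ring
  rw [h2, hcos, Real.sin_two_mul]
  rcases eq_or_ne (Real.sin (ω / 2 / v)) 0 with hs | hs
  · simp [hs]
  · field_simp

/-- Properties of `G(v) = v·sin(ω/v)/(1 − cos(ω/v))` on `(ω/(2π), ∞)`: it is
strictly increasing, vanishes at `ω/π`, tends to `−∞` at the left endpoint and
to `+∞` at infinity; in particular it is negative on `(ω/(2π), ω/π)` and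
positive on `(ω/π, ∞)`. -/
theorem G_properties (ω : ℝ) (hω : 0 < ω)
    (G : ℝ → ℝ)
    (hG : ∀ v : ℝ, G v = v * Real.sin (ω / v) / (1 - Real.cos (ω / v))) :
    StrictMonoOn G (Set.Ioi (ω / (2 * π))) ∧
    G (ω / π) = 0 ∧
    Tendsto G (nhdsWithin (ω / (2 * π)) (Set.Ioi (ω / (2 * π)))) atBot ∧
    Tendsto G atTop atTop ∧
    (∀ v ∈ Set.Ioo (ω / (2 * π)) (ω / π), G v < 0) ∧
    (∀ v : ℝ, ω / π < v → 0 < G v) := by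
  have hω2 : 0 < ω / 2 := half_pos hω
  have hGeq : G = fun v => ω / 2 *
      (Real.cos (ω / 2 / v) / (ω / 2 / v * Real.sin (ω / 2 / v))) :=
    funext fun v => (hG v).trans (mul_sin_div_one_sub_cos_eq hω.ne' v)
  have hend : ω / (2 * π) = ω / 2 / π := by rw [div_div]
  have hendpos : 0 < ω / (2 * π) := by positivity
  have hmem : ∀ v ∈ Set.Ioi (ω / (2 * π)), ω / 2 / v ∈ Set.Ioo 0 π := by
    intro v hv
    rw [Set.mem_Ioi] at hv
    refine ⟨div_pos hω2 (hendpos.trans hv), ?_⟩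
    rw [hend] at hv
    exact (div_lt_comm₀ Real.pi_pos (hendpos.trans (hend ▸ hv))).1 hv
  have hmono : StrictMonoOn G (Set.Ioi (ω / (2 * π))) := by
    rw [hGeq]
    intro v hv w hw hvw
    exact mul_lt_mul_of_pos_left (strictAntiOn_cos_div_mul_sin (hmem w hw) (hmem v hv)
      (div_lt_div_of_pos_left hω2 (hendpos.trans hv) hvw)) hω2
  have hzero : G (ω / π) = 0 := by
    rw [hG, div_div_cancel₀ hω.ne', Real.sin_pi]
    simp
  have hmid : ω / (2 * π) < ω / π :=
    div_lt_div_of_pos_left hω Real.pi_pos (by linarith [Real.pi_pos])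
  refine ⟨hmono, hzero, ?_, ?_, fun v hv => ?_, fun v hv => ?_⟩
  · rw [hGeq]
    refine (tendsto_cos_div_mul_sin_pi.comp
      (tendsto_nhdsWithin_iff.2 ⟨?_, ?_⟩)).const_mul_atBot hω2
    · have hlim : Tendsto (fun v : ℝ => ω / 2 / v) (𝓝 (ω / (2 * π)))
          (𝓝 (ω / 2 / (ω / (2 * π)))) :=
        tendsto_const_nhds.div tendsto_id hendpos.ne'
      rw [hend, div_div_cancel₀ hω2.ne', ← hend] at hlim
      exact hlim.mono_left nhdsWithin_le_nhds
    · filter_upwards [self_mem_nhdsWithin] with v hv using (hmem v hv).2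
  · rw [hGeq]
    refine (tendsto_cos_div_mul_sin_zero.comp
      (tendsto_nhdsWithin_iff.2 ⟨?_, ?_⟩)).const_mul_atTop hω2
    · exact tendsto_const_nhds.div_atTop tendsto_id
    · filter_upwards [eventually_gt_atTop 0] with v hv using div_pos hω2 hv
  · exact hzero ▸ hmono hv.1 hmid hv.2
  · exact hzero ▸ hmono hmid (hmid.trans hv) hv
end

section
/- The function H(v) = (1 + v·sin(1/v)) / (v²·(1 − cos(1/v))) is strictly decreasing on the interval (1/(2π), ∞). -/
open Set Real

/-- The Mitrinović–Adamović inequality `cos t ≤ (sin t / t) ^ 3`. -/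
theorem cube_mul_cos_le_sin_cube {t : ℝ} (h0 : 0 < t) (h1 : t < 2) :
    t ^ 3 * cos t ≤ sin t ^ 3 := by
  have hs := sin_ge_sub_cube h0.le
  have hh := sin_ge_sub_cube (half_pos h0).le
  have hy : t ^ 2 < 4 := by nlinarith
  have hh0 : 0 ≤ t / 2 - (t / 2) ^ 3 / 6 := by nlinarith
  have hs0 : 0 ≤ t - t ^ 3 / 6 := by nlinarith
  have hc : cos t ≤ 1 - t ^ 2 / 2 + t ^ 4 / 24 := by
    have h2 : cos t = 1 - 2 * sin (t / 2) ^ 2 := by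
      rw [← mul_div_cancel₀ t (two_ne_zero' ℝ), mul_div_assoc, cos_two_mul, cos_sq']
      ring_nf
    have h3 := pow_le_pow_left₀ hh0 hh 2
    nlinarith [sq_nonneg (t ^ 3)]
  calc t ^ 3 * cos t ≤ t ^ 3 * (1 - t ^ 2 / 2 + t ^ 4 / 24) := by gcongr
    _ ≤ (t - t ^ 3 / 6) ^ 3 := by
      have : 0 ≤ t ^ 7 * (9 - t ^ 2) := mul_nonneg (by positivity) (by linarith)
      nlinarith
    _ ≤ sin t ^ 3 := pow_le_pow_left₀ hs0 hs 3

theorem mul_sin_sub_two_mul_sq_mul_cos_add_pos {t : ℝ} (h0 : 0 < t) (h1 : t < π) :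
    0 < t * sin t - 2 * t ^ 2 * cos t + cos t * sin t ^ 2 := by
  have hs : 0 < sin t := sin_pos_of_pos_of_lt_pi h0 h1
  have hst : sin t < t := sin_lt h0
  have hsq : sin t ^ 2 < t ^ 2 := pow_lt_pow_left₀ hst hs.le two_ne_zero
  have hp : 0 < t * sin t := mul_pos h0 hs
  rcases le_or_gt (cos t) 0 with hc | hc
  · nlinarith
  · have ht2 : t < 2 := by
      by_contra! h
      have := cos_nonpos_of_pi_div_two_le_of_le (x := t) (by linarith [pi_lt_four])
        (by linarith)
      linarith
    have hk := cube_mul_cos_le_sin_cube h0 ht2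
    have hc1 : cos t * sin t ^ 2 < t * sin t := by
      have : cos t * sin t ^ 2 ≤ sin t ^ 2 := by nlinarith [cos_le_one t, sq_nonneg (sin t)]
      nlinarith
    -- AM-GM, made strict by `hc1`
    have h4 : (2 * t ^ 2 * cos t) ^ 2 ≤ 4 * (t * sin t) * (cos t * sin t ^ 2) := by
      have := mul_le_mul_of_nonneg_left hk (mul_pos h0 hc).le
      nlinarith
    have h5 : (2 * t ^ 2 * cos t) ^ 2 < (t * sin t + cos t * sin t ^ 2) ^ 2 := by
      nlinarith [pow_pos (sub_pos.2 hc1) 2]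
    have := lt_of_pow_lt_pow_left₀ 2 (by positivity) h5
    linarith

theorem strictMonoOn_sq_div_sin_sq_add_mul_cot :
    StrictMonoOn (fun t : ℝ => t ^ 2 / sin t ^ 2 + t * cos t / sin t) (Ioo 0 π) := by
  have hd : ∀ t ∈ Ioo 0 π, HasDerivAt (fun t : ℝ => t ^ 2 / sin t ^ 2 + t * cos t / sin t)
      ((t * sin t - 2 * t ^ 2 * cos t + cos t * sin t ^ 2) / sin t ^ 3) t := by
    intro t ht
    have hs : sin t ≠ 0 := (sin_pos_of_mem_Ioo ht).ne'
    refine (((hasDerivAt_pow 2 t).div ((hasDerivAt_sin t).pow 2) (pow_ne_zero 2 hs)).add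
      (((hasDerivAt_id t).mul (hasDerivAt_cos t)).div (hasDerivAt_sin t) hs)).congr_deriv ?_
    simp only [id, Pi.pow_apply, Pi.mul_apply]
    field_simp
    push_cast
    ring_nf
    simp only [cos_sq']
    ring
  refine strictMonoOn_of_deriv_pos (convex_Ioo 0 π)
    (fun t ht => (hd t ht).continuousAt.continuousWithinAt) fun t ht => ?_
  rw [interior_Ioo] at ht
  rw [(hd t ht).deriv]
  exact div_pos (mul_sin_sub_two_mul_sq_mul_cos_add_pos ht.1 ht.2)
    (pow_pos (sin_pos_of_mem_Ioo ht) 3)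

/-- The function `H(v) = (1 + v·sin(1/v))/(v²·(1 − cos(1/v)))` is strictly
decreasing on `(1/(2π), ∞)`. -/
theorem H_strictAnti (H : ℝ → ℝ)
    (hH : ∀ v : ℝ, H v = (1 + v * Real.sin (1 / v)) / (v ^ 2 * (1 - Real.cos (1 / v)))) :
    StrictAntiOn H (Set.Ioi (1 / (2 * π))) := by
  have hpos : ∀ v ∈ Ioi (1 / (2 * π)), 0 < v := fun v hv =>
    lt_trans (by positivity) hv
  have hmem : ∀ v ∈ Ioi (1 / (2 * π)), 1 / (2 * v) ∈ Ioo 0 π := by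
    intro v hv
    have hv0 := hpos v hv
    refine ⟨by positivity, ?_⟩
    rw [mem_Ioi, div_lt_iff₀ (by positivity)] at hv
    rw [div_lt_iff₀ (by positivity)]
    linarith
  have hform : ∀ v ∈ Ioi (1 / (2 * π)), H v = 2 * ((1 / (2 * v)) ^ 2 / sin (1 / (2 * v)) ^ 2 +
      1 / (2 * v) * cos (1 / (2 * v)) / sin (1 / (2 * v))) := by
    intro v hv
    have hv0 := hpos v hv
    have hs := sin_pos_of_mem_Ioo (hmem v hv)
    have hx : 1 / v = 2 * (1 / (2 * v)) := by field_simp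
    have hc : 1 - cos (1 / v) = 2 * sin (1 / (2 * v)) ^ 2 := by
      rw [hx, cos_two_mul, cos_sq']
      ring
    rw [hH, hc, hx, sin_two_mul]
    generalize sin (1 / (2 * v)) = s at *
    generalize cos (1 / (2 * v)) = c at *
    field_simp
  intro a ha b hb hab
  have ha0 := hpos a ha
  have hlt : 1 / (2 * b) < 1 / (2 * a) := by gcongr
  have := strictMonoOn_sq_div_sin_sq_add_mul_cot (hmem b hb) (hmem a ha) hlt
  rw [hform a ha, hform b hb]
  linarith
end

section
/- Define h(x) = (cos x − 1)(sin x + x) + x²·sin x. Then h(0) = h(2π) = 0 and h(x) < 0 for every x ∈ (0, 2π). -/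
open Real

lemma cos_le_one_sub_sq_div_two_add_pow_four_div {t : ℝ} (h0 : 0 ≤ t) (h4 : t ≤ 4) :
    cos t ≤ 1 - t ^ 2 / 2 + t ^ 4 / 24 := by
  have hs := sin_ge_sub_cube (x := t / 2) (by linarith)
  have hpos : 0 ≤ t / 2 - (t / 2) ^ 3 / 6 := by
    have : 0 ≤ t * (24 - t ^ 2) := mul_nonneg h0 (by nlinarith)
    linarith
  have hsq := pow_le_pow_left₀ hpos hs 2
  have hcos : cos t = 1 - 2 * sin (t / 2) ^ 2 := by
    rw [← mul_div_cancel₀ t (two_ne_zero' ℝ), mul_div_assoc, cos_two_mul, cos_sq']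
    ring_nf
  nlinarith [sq_nonneg (t ^ 3)]

/-- The Mitrinović–Adamović inequality. -/
lemma pow_three_mul_cos_lt_sin_pow_three {t : ℝ} (h0 : 0 < t) (h2 : t < 2) :
    t ^ 3 * cos t < sin t ^ 3 := by
  have hpos : 0 ≤ t - t ^ 3 / 6 := by
    have : 0 ≤ t * (6 - t ^ 2) := mul_nonneg h0.le (by nlinarith)
    linarith
  calc t ^ 3 * cos t ≤ t ^ 3 * (1 - t ^ 2 / 2 + t ^ 4 / 24) := by
        gcongr
        exact cos_le_one_sub_sq_div_two_add_pow_four_div h0.le (by linarith)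
    _ < (t - t ^ 3 / 6) ^ 3 := by
        have : 0 < t ^ 7 * (9 - t ^ 2) := mul_pos (by positivity) (by nlinarith)
        linarith
    _ ≤ sin t ^ 3 := pow_le_pow_left₀ hpos (sin_ge_sub_cube h0.le) 3

lemma two_mul_sq_sub_sin_sq_mul_cos_lt {t : ℝ} (h0 : 0 < t) (hπ : t < π) :
    (2 * t ^ 2 - sin t ^ 2) * cos t < t * sin t := by
  have hs : 0 < sin t := sin_pos_of_pos_of_lt_pi h0 hπ
  have hst : sin t < t := sin_lt h0
  have hcoef : 0 < 2 * t ^ 2 - sin t ^ 2 := by nlinarith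
  rcases lt_or_ge t (π / 2) with ht | ht
  · have hc := pow_three_mul_cos_lt_sin_pow_three h0 (by linarith [pi_le_four])
    refine lt_of_mul_lt_mul_left ?_ (by positivity : 0 ≤ t ^ 3)
    have hsq : 0 ≤ sin t * (t ^ 2 - sin t ^ 2) ^ 2 := by positivity
    have := mul_lt_mul_of_pos_left hc hcoef
    linarith
  · have hc : cos t ≤ 0 := cos_nonpos_of_pi_div_two_le_of_le ht (by linarith)
    exact (mul_nonpos_of_nonneg_of_nonpos hcoef.le hc).trans_lt (by positivity)

/-- The function `h(x) = (cos x − 1)(sin x + x) + x²·sin x` vanishes at `0` and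
`2π` and is strictly negative on `(0, 2π)`. -/
theorem h_neg_on_Ioo (h : ℝ → ℝ)
    (hh : ∀ x : ℝ, h x = (Real.cos x - 1) * (Real.sin x + x) + x ^ 2 * Real.sin x) :
    h 0 = 0 ∧ h (2 * π) = 0 ∧ ∀ x ∈ Set.Ioo (0:ℝ) (2 * π), h x < 0 := by
  refine ⟨by simp [hh], by simp [hh], fun x hx => ?_⟩
  obtain ⟨t, rfl⟩ : ∃ t, x = 2 * t := ⟨x / 2, by ring⟩
  have h0 : 0 < t := by linarith [hx.1]
  have hπ : t < π := by linarith [hx.2]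
  have key : h (2 * t) =
      4 * sin t * ((2 * t ^ 2 - sin t ^ 2) * cos t - t * sin t) := by
    rw [hh, cos_two_mul, sin_two_mul, cos_sq']
    ring
  rw [key]
  exact mul_neg_of_pos_of_neg (mul_pos four_pos (sin_pos_of_pos_of_lt_pi h0 hπ))
    (sub_neg.mpr (two_mul_sq_sub_sin_sq_mul_cos_lt h0 hπ))
end

section
/- For every real x, the function h(x) = (cos x − 1)(sin x + x) + x²·sin x admits the convergent power series expansion h(x) = Σ_{k=3}^{∞} (−1)^k · (2^{2k} − 4k²) / (2k+1)! · x^{2k+1}; in particular, the coefficients of x^{2k+1} vanish for k = 0, 1, 2. -/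
open Real

/-- The power series of `x² sin x`, indexed by the exponent `2k + 1`. -/
lemma hasSum_sq_mul_sin (x : ℝ) :
    HasSum (fun k : ℕ => -((-1 : ℝ) ^ k * ((2 * k) * (2 * k + 1)) /
      (Nat.factorial (2 * k + 1)) * x ^ (2 * k + 1))) (x ^ 2 * sin x) := by
  rw [← hasSum_nat_add_iff' 1]
  convert! (Real.hasSum_sin x).mul_left (x ^ 2) using 1
  · ext k
    have hk : ((2 * k + 1).factorial : ℝ) ≠ 0 := by positivity
    rw [show 2 * (k + 1) + 1 = (2 * k + 1) + 1 + 1 by ring, Nat.factorial_succ,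
      Nat.factorial_succ]
    push_cast
    field_simp
    ring
  · simp

/-- The power series of `(cos x - 1) (sin x + x) + x² sin x + x`; the extra `x` is its term of
index `k = 0`. -/
lemma hasSum_cos_sub_one_mul_sin_add (x : ℝ) :
    HasSum (fun k : ℕ => (-1 : ℝ) ^ k * ((2 : ℝ) ^ (2 * k) - 4 * (k : ℝ) ^ 2) /
      (Nat.factorial (2 * k + 1)) * x ^ (2 * k + 1))
      ((cos x - 1) * (sin x + x) + x ^ 2 * sin x + x) := by
  have h2 := (Real.hasSum_sin (2 * x)).div_const 2
  have h := ((h2.sub (Real.hasSum_sin x)).add ((Real.hasSum_cos x).mul_left x)).add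
    (hasSum_sq_mul_sin x)
  convert! h using 1
  · ext k
    have hk : ((2 * k).factorial : ℝ) ≠ 0 := by positivity
    rw [Nat.factorial_succ]
    push_cast
    field_simp
    ring
  · rw [sin_two_mul]
    ring

lemma deriv_cos_sub_one_mul_sin_add :
    deriv (fun x : ℝ => (cos x - 1) * (sin x + x) + x ^ 2 * sin x) =
      fun x => cos (2 * x) - 1 + x * sin x + x ^ 2 * cos x := by
  ext x
  have h := (((hasDerivAt_cos x).sub_const 1).mul ((hasDerivAt_sin x).add (hasDerivAt_id x))).add
    ((hasDerivAt_pow 2 x).mul (hasDerivAt_sin x))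
  refine h.deriv.trans ?_
  simp only [Pi.add_apply, id, cos_two_mul]
  push_cast
  linear_combination -(sin_sq_add_cos_sq x)

/-- Functions of the form `a sin 2x + b cos 2x + p(x) sin x + q(x) cos x + e`, with `p` and `q`
quadratic, have a derivative of the same form. -/
lemma deriv_trigCombination (a b c₀ c₁ c₂ d₀ d₁ d₂ e : ℝ) :
    deriv (fun x : ℝ => a * sin (2 * x) + b * cos (2 * x) + (c₀ + c₁ * x + c₂ * x ^ 2) * sin x +
      (d₀ + d₁ * x + d₂ * x ^ 2) * cos x + e) =
    fun x => (-2 * b) * sin (2 * x) + (2 * a) * cos (2 * x) +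
      ((c₁ - d₀) + (2 * c₂ - d₁) * x + (-d₂) * x ^ 2) * sin x +
      ((c₀ + d₁) + (c₁ + 2 * d₂) * x + c₂ * x ^ 2) * cos x + 0 := by
  have quad (u v w x : ℝ) :
      HasDerivAt (fun x : ℝ => u + v * x + w * x ^ 2) (v + 2 * w * x) x := by
    have := (((hasDerivAt_id x).const_mul v).const_add u).add ((hasDerivAt_pow 2 x).const_mul w)
    refine this.congr_deriv ?_
    push_cast
    ring
  ext x
  have h2 : HasDerivAt (fun x : ℝ => 2 * x) 2 x := by
    simpa using (hasDerivAt_id x).const_mul (2 : ℝ)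
  have h := (((h2.sin.const_mul a).add (h2.cos.const_mul b)).add
    ((quad c₀ c₁ c₂ x).mul (hasDerivAt_sin x))).add
    ((quad d₀ d₁ d₂ x).mul (hasDerivAt_cos x))
  refine (h.add_const e).deriv.trans ?_
  ring

/-- The convergent power series expansion
`h(x) = Σ_{k=3}^∞ (−1)^k (2^{2k} − 4k²)/(2k+1)! · x^{2k+1}` of
`h(x) = (cos x − 1)(sin x + x) + x² sin x` (the sum below runs over `k = j + 3`,
`j : ℕ`); in particular the Taylor coefficients of `x^{2k+1}` vanish for
`k = 0, 1, 2`. -/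
theorem h_powerSeries (h : ℝ → ℝ)
    (hh : ∀ x : ℝ, h x = (Real.cos x - 1) * (Real.sin x + x) + x ^ 2 * Real.sin x) :
    (∀ x : ℝ, HasSum
      (fun j : ℕ =>
        (-1 : ℝ) ^ (j + 3) * ((2 : ℝ) ^ (2 * (j + 3)) - 4 * ((j : ℝ) + 3) ^ 2) /
          (Nat.factorial (2 * (j + 3) + 1)) * x ^ (2 * (j + 3) + 1))
      (h x)) ∧
    iteratedDeriv 1 h 0 = 0 ∧ iteratedDeriv 3 h 0 = 0 ∧ iteratedDeriv 5 h 0 = 0 := by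
  obtain rfl : h = fun x => (cos x - 1) * (sin x + x) + x ^ 2 * sin x := funext hh
  have hderiv : deriv (fun x : ℝ => (cos x - 1) * (sin x + x) + x ^ 2 * sin x) =
      fun x => 0 * sin (2 * x) + 1 * cos (2 * x) + (0 + 1 * x + 0 * x ^ 2) * sin x +
        (0 + 0 * x + 1 * x ^ 2) * cos x + (-1) := by
    rw [deriv_cos_sub_one_mul_sin_add]
    ext x
    ring
  refine ⟨fun x => ?_, ?_, ?_, ?_⟩
  · have hs := (hasSum_nat_add_iff' 3).mpr (hasSum_cos_sub_one_mul_sin_add x)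
    convert! hs using 1
    · ext j
      push_cast
      ring
    · norm_num [Finset.sum_range_succ]
  all_goals
    simp only [iteratedDeriv_succ', iteratedDeriv_zero, hderiv, deriv_trigCombination]
    norm_num
end

section
/- Let h(x) = (cos x − 1)(sin x + x) + x²·sin x. Then for every x ∈ (0, π] one has −x⁷/180 < h(x) < −(x⁷/180)·(1 − (2/21)·x²). -/
open Real
open scoped Nat

/-- The absolute value of the coefficient of `x ^ (2 * k + 1)` in the power series of
`(cos x - 1) * (sin x + x) + x ^ 2 * sin x`, multiplied by `x ^ (2 * k + 1)`. -/
noncomputable def hTerm (x : ℝ) (k : ℕ) : ℝ :=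
  (4 ^ k - 4 * (k : ℝ) ^ 2) * x ^ (2 * k + 1) / (2 * k + 1)!

theorem hasSum_neg_one_pow_mul_hTerm (x : ℝ) :
    HasSum (fun n : ℕ ↦ (-1 : ℝ) ^ n * hTerm x (n + 3))
      (-((cos x - 1) * (sin x + x) + x ^ 2 * sin x)) := by
  have h₁ := (hasSum_nat_add_iff' 3).2 (hasSum_sin (2 * x))
  have h₂ := (hasSum_nat_add_iff' 3).2 (hasSum_cos x)
  have h₃ := (hasSum_nat_add_iff' 3).2 (hasSum_sin x)
  have h₄ := (hasSum_nat_add_iff' 2).2 (hasSum_sin x)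
  convert! ((((h₁.div_const 2).add (h₂.mul_left x)).sub h₃).add (h₄.mul_left (x ^ 2))).neg using 1
  · funext n
    have e₁ : (2 * (n + 3) + 1)! = (2 * n + 7) * ((2 * n + 6) * (2 * n + 5)!) := rfl
    have e₂ : (2 * (n + 3))! = (2 * n + 6) * (2 * n + 5)! := rfl
    have e₃ : (2 * (n + 2) + 1)! = (2 * n + 5)! := rfl
    have e₄ : (4 : ℝ) ^ n = 2 ^ (n * 2) := by rw [mul_comm, pow_mul]; norm_num
    rw [hTerm, e₁, e₂, e₃]
    have hpos : ((2 * n + 5)! : ℝ) ≠ 0 := by positivity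
    have h6 : (2 * n + 6 : ℝ) ≠ 0 := by positivity
    have h7 : (2 * n + 7 : ℝ) ≠ 0 := by positivity
    push_cast
    field_simp
    ring_nf
    rw [e₄]
  · rw [sin_two_mul]
    simp only [Finset.sum_range_succ, Finset.sum_range_zero, Nat.factorial]
    push_cast
    ring

theorem four_mul_sq_lt_four_pow {k : ℕ} (hk : 3 ≤ k) : 4 * (k : ℝ) ^ 2 < 4 ^ k := by
  induction k, hk using Nat.le_induction with
  | base => norm_num
  | succ k hk ih =>
    have : (3 : ℝ) ≤ k := by exact_mod_cast hk
    rw [pow_succ (4 : ℝ) k]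
    push_cast
    nlinarith

theorem twelve_mul_sq_le_four_pow {k : ℕ} (hk : 4 ≤ k) : 12 * (k : ℝ) ^ 2 ≤ 4 ^ k := by
  induction k, hk using Nat.le_induction with
  | base => norm_num
  | succ k hk ih =>
    have : (4 : ℝ) ≤ k := by exact_mod_cast hk
    rw [pow_succ (4 : ℝ) k]
    push_cast
    nlinarith

theorem ten_mul_coeff_le {k : ℕ} (hk : 3 ≤ k) :
    10 * ((4 : ℝ) ^ (k + 1) - 4 * ((k : ℝ) + 1) ^ 2) ≤
      (2 * k + 3) * (2 * k + 2) * (4 ^ k - 4 * (k : ℝ) ^ 2) := by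
  rcases hk.eq_or_lt with rfl | hk'
  · norm_num
  have h4 : (4 : ℝ) ≤ k := by exact_mod_cast hk'
  have hc := twelve_mul_sq_le_four_pow hk'
  rw [pow_succ (4 : ℝ) k]
  nlinarith [mul_le_mul_of_nonneg_right
    (show (110 : ℝ) ≤ (2 * k + 3) * (2 * k + 2) by nlinarith)
    (show (0 : ℝ) ≤ 4 ^ k - 4 * (k : ℝ) ^ 2 by nlinarith)]

theorem hTerm_succ_lt {x : ℝ} (hx : 0 < x) (hx' : x ^ 2 < 10) {k : ℕ} (hk : 3 ≤ k) :
    hTerm x (k + 1) < hTerm x k := by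
  have hc := four_mul_sq_lt_four_pow (Nat.le_succ_of_le hk)
  have hle := ten_mul_coeff_le hk
  have e : (2 * (k + 1) + 1)! = (2 * k + 3) * ((2 * k + 2) * (2 * k + 1)!) := rfl
  have e' : x ^ (2 * (k + 1) + 1) = x ^ 2 * x ^ (2 * k + 1) := by ring
  rw [hTerm, hTerm, e, e', div_lt_div_iff₀ (by positivity) (by positivity)]
  push_cast [Nat.succ_eq_add_one] at hc ⊢
  have hpos : 0 < x ^ (2 * k + 1) * ((2 * k + 1)! : ℝ) := by positivity
  have key : ((4 : ℝ) ^ (k + 1) - 4 * ((k : ℝ) + 1) ^ 2) * x ^ 2 <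
      (2 * k + 3) * (2 * k + 2) * (4 ^ k - 4 * (k : ℝ) ^ 2) := by
    nlinarith [mul_lt_mul_of_pos_left hx' (sub_pos.2 hc)]
  linear_combination (x ^ (2 * k + 1) * ((2 * k + 1)! : ℝ)) * key

/-- Two-sided bound: for `x ∈ (0, π]`,
`−x⁷/180 < h(x) < −(x⁷/180)·(1 − (2/21)x²)` where
`h(x) = (cos x − 1)(sin x + x) + x² sin x`. -/
theorem h_two_sided_bound (h : ℝ → ℝ)
    (hh : ∀ x : ℝ, h x = (Real.cos x - 1) * (Real.sin x + x) + x ^ 2 * Real.sin x) :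
    ∀ x ∈ Set.Ioc (0:ℝ) π,
      -x ^ 7 / 180 < h x ∧ h x < -(x ^ 7 / 180) * (1 - (2 / 21) * x ^ 2) := by
  rintro x ⟨hx, hxπ⟩
  have hx' : x ^ 2 < 10 := by nlinarith [pi_lt_d2]
  have hlt (n : ℕ) : hTerm x (n + 1 + 3) < hTerm x (n + 3) := by
    simpa only [add_right_comm n 1 3] using hTerm_succ_lt hx hx' (Nat.le_add_left 3 n)
  have hanti : Antitone fun n ↦ hTerm x (n + 3) := antitone_nat_of_succ_le fun n ↦ (hlt n).le
  have hsum := (hasSum_neg_one_pow_mul_hTerm x).tendsto_sum_nat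
  have upper := hanti.tendsto_le_alternating_series hsum 1
  have lower := hanti.alternating_series_le_tendsto hsum 2
  have h₁ := hlt 1
  have h₂ := hlt 2
  have t₀ : hTerm x 3 = x ^ 7 / 180 := by
    norm_num [hTerm, Nat.factorial]
    ring
  have t₁ : hTerm x 4 = x ^ 9 / 1890 := by
    norm_num [hTerm, Nat.factorial]
    ring
  norm_num [Finset.sum_range_succ, t₀, t₁] at upper lower h₁ h₂
  rw [hh]
  constructor <;> linarith
end
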